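/- Fix integers 1 ≤ d ≤ d' and a real s > d. Let A ⊆ ℝ^{d'} be a d-rectifiable manifold with H_d(A) > 0, and for each N let ω_N ⊆ A be an N-point configuration such that E_s(ω_N)/N^{1+s/d} converges, as N → ∞, to the same (finite) limit as ℰ_s(A,N)/N^{1+s/d}. Then for every bounded continuous function f : ℝ^{d'} → ℝ, (1/N)∑_{x∈ω_N} f(x) → (1/H_d(A)) ∫_A f dH_d as N → ∞; that is, the configurations are asymptotically uniformly distributed with respect to H_d on A. -/

import Mathlib

open scoped ENNReal NNReal BigOperators Classical
open MeasureTheory Filter Metric Set Topology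

/-- The Riesz `s`-energy of a finite configuration `ω`, valued in `[0,∞]`. -/
noncomputable def rieszEnergy {E : Type*} [PseudoEMetricSpace E] (s : ℝ) (ω : Finset E) : ℝ≥0∞ :=
  ∑ x ∈ ω, ∑ y ∈ ω, if x = y then 0 else edist x y ^ (-s)

/-- The `N`-point minimal Riesz `s`-energy over a set `A` (infimum over all `N`-point
subsets of `A`; `∞` if there is none). -/
noncomputable def minRieszEnergy {E : Type*} [PseudoEMetricSpace E] (s : ℝ) (A : Set E)
    (N : ℕ) : ℝ≥0∞ :=
  ⨅ (ω : Finset E) (_ : ↑ω ⊆ A) (_ : ω.card = N), rieszEnergy s ω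

/-- `A ⊆ ℝ^{d'}` is a `d`-rectifiable manifold: a finite union of images of compact subsets
of `ℝ^d` under maps that are bi-Lipschitz on open neighborhoods of those compact sets. -/
def IsRectifiableManifold (d d' : ℕ) (A : Set (EuclideanSpace ℝ (Fin d'))) : Prop :=
  ∃ (n : ℕ) (K : Fin n → Set (EuclideanSpace ℝ (Fin d)))
    (φ : Fin n → EuclideanSpace ℝ (Fin d) → EuclideanSpace ℝ (Fin d')),
    (∀ k, IsCompact (K k)) ∧
    (∀ k, ∃ (G : Set (EuclideanSpace ℝ (Fin d))) (L : ℝ), IsOpen G ∧ K k ⊆ G ∧ 1 ≤ L ∧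
      ∀ x ∈ G, ∀ y ∈ G,
        (1 / L) * dist x y ≤ dist (φ k x) (φ k y) ∧ dist (φ k x) (φ k y) ≤ L * dist x y) ∧
    A = ⋃ k, φ k '' K k

/-- The unit cube `[0,1]^d` in `ℝ^d`. -/
def unitCube (d : ℕ) : Set (EuclideanSpace ℝ (Fin d)) := {x | ∀ i, x i ∈ Set.Icc (0 : ℝ) 1}

/-- `d`-dimensional Hausdorff measure on `ℝ^{d'}`, normalized so that the unit cube of `ℝ^d`
has measure `1`. -/
noncomputable def normHausdorff (d d' : ℕ) : Measure (EuclideanSpace ℝ (Fin d')) :=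
  (μH[(d : ℝ)] (unitCube d))⁻¹ • μH[(d : ℝ)]

namespace RieszEnergy

/-- The real-valued Riesz `s`-energy of the finite family `x i`, `i ∈ I`. -/
noncomputable def energy {ι E : Type*} [PseudoMetricSpace E] (s : ℝ) (I : Finset ι) (x : ι → E) :
    ℝ :=
  ∑ i ∈ I, ∑ j ∈ I, if i = j then 0 else dist (x i) (x j) ^ (-s)

section Energy

variable {ι κ E F : Type*} [MetricSpace E] [MetricSpace F] {s : ℝ}

theorem energy_term_nonneg (x : ι → E) (i j : ι) :
    0 ≤ if i = j then (0 : ℝ) else dist (x i) (x j) ^ (-s) := by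
  split_ifs <;> positivity

theorem energy_nonneg (I : Finset ι) (x : ι → E) : 0 ≤ energy s I x :=
  Finset.sum_nonneg fun _ _ => Finset.sum_nonneg fun _ _ => energy_term_nonneg x _ _

theorem energy_image [DecidableEq E] {I : Finset ι} {x : ι → E} (hx : Set.InjOn x I) :
    energy s (I.image x) id = energy s I x := by
  unfold energy
  rw [Finset.sum_image hx]
  refine Finset.sum_congr rfl fun i hi => ?_
  rw [Finset.sum_image hx]
  refine Finset.sum_congr rfl fun j hj => ?_
  simp [hx.eq_iff hi hj]

theorem energy_mono {I J : Finset ι} (h : J ⊆ I) (x : ι → E) : energy s J x ≤ energy s I x := by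
  unfold energy
  calc _ ≤ ∑ i ∈ J, ∑ j ∈ I, if i = j then (0 : ℝ) else dist (x i) (x j) ^ (-s) :=
        Finset.sum_le_sum fun i _ =>
          Finset.sum_le_sum_of_subset_of_nonneg h fun _ _ _ => energy_term_nonneg x _ _
    _ ≤ _ := Finset.sum_le_sum_of_subset_of_nonneg h fun _ _ _ =>
        Finset.sum_nonneg fun _ _ => energy_term_nonneg x _ _

theorem term_le_energy {I : Finset ι} (x : ι → E) {i j : ι} (hi : i ∈ I) (hj : j ∈ I)
    (hij : i ≠ j) : dist (x i) (x j) ^ (-s) ≤ energy s I x := by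
  unfold energy
  calc dist (x i) (x j) ^ (-s) = if i = j then (0 : ℝ) else dist (x i) (x j) ^ (-s) := by
        simp [hij]
    _ ≤ ∑ j ∈ I, if i = j then (0 : ℝ) else dist (x i) (x j) ^ (-s) :=
        Finset.single_le_sum (f := fun j => if i = j then (0 : ℝ) else dist (x i) (x j) ^ (-s))
          (fun _ _ => energy_term_nonneg x _ _) hj
    _ ≤ _ := Finset.single_le_sum
          (f := fun i => ∑ j ∈ I, if i = j then (0 : ℝ) else dist (x i) (x j) ^ (-s))
          (fun _ _ => Finset.sum_nonneg fun _ _ => energy_term_nonneg x _ _) hi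

/-- If distances shrink at most by the factor `c`, the energy grows at most by `c ^ (-s)`. -/
theorem energy_le_of_dist_le (hs : 0 ≤ s) {c : ℝ} (hc : 0 < c) {I : Finset ι} {x : ι → E}
    {y : ι → F} (hx : ∀ i ∈ I, ∀ j ∈ I, i ≠ j → x i ≠ x j)
    (h : ∀ i ∈ I, ∀ j ∈ I, i ≠ j → c * dist (x i) (x j) ≤ dist (y i) (y j)) :
    energy s I y ≤ c ^ (-s) * energy s I x := by
  unfold energy
  simp_rw [Finset.mul_sum]
  refine Finset.sum_le_sum fun i hi => Finset.sum_le_sum fun j hj => ?_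
  split_ifs with hij
  · simp
  · have hpos : 0 < dist (x i) (x j) := dist_pos.2 (hx i hi j hj hij)
    rw [← Real.mul_rpow hc.le hpos.le]
    exact Real.rpow_le_rpow_of_nonpos (by positivity) (h i hi j hj hij) (by linarith)

theorem sum_energy_fiber_le [DecidableEq κ] (I : Finset ι) (x : ι → E) (c : ι → κ) (T : Finset κ) :
    ∑ k ∈ T, energy s (I.filter fun i => c i = k) x ≤ energy s I x := by
  have h1 : ∀ k ∈ T, energy s (I.filter fun i => c i = k) x ≤
      ∑ i ∈ I.filter (fun i => c i = k), ∑ j ∈ I,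
        if i = j then (0 : ℝ) else dist (x i) (x j) ^ (-s) := fun k _ =>
    Finset.sum_le_sum fun i _ => Finset.sum_le_sum_of_subset_of_nonneg (Finset.filter_subset _ _)
      fun _ _ _ => energy_term_nonneg x _ _
  refine (Finset.sum_le_sum h1).trans ?_
  have h2 := Finset.sum_fiberwise_eq_sum_filter I T c fun i =>
    ∑ j ∈ I, if i = j then (0 : ℝ) else dist (x i) (x j) ^ (-s)
  refine (le_of_eq ?_).trans (h2.le.trans ?_)
  · congr!
  exact Finset.sum_le_sum_of_subset_of_nonneg (Finset.filter_subset _ _) fun _ _ _ =>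
    Finset.sum_nonneg fun _ _ => energy_term_nonneg x _ _

theorem energy_le_sum_energy_fiber [DecidableEq κ] (hs : 0 ≤ s) {I : Finset ι} {x : ι → E}
    {c : ι → κ} {T : Finset κ} (hT : ∀ i ∈ I, c i ∈ T) {D : ℝ} (hD : 0 < D)
    (h : ∀ i ∈ I, ∀ j ∈ I, c i ≠ c j → D ≤ dist (x i) (x j)) :
    energy s I x ≤
      ∑ k ∈ T, energy s (I.filter fun i => c i = k) x + (I.card : ℝ) ^ 2 * D ^ (-s) := by
  have h1 : ∑ k ∈ T, energy s (I.filter fun i => c i = k) x =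
      ∑ i ∈ I, ∑ j ∈ I, if c j = c i then
        (if i = j then (0 : ℝ) else dist (x i) (x j) ^ (-s)) else 0 := by
    rw [← Finset.sum_fiberwise_of_maps_to hT]
    refine Finset.sum_congr rfl fun k _ => Finset.sum_congr rfl fun i hi => ?_
    rw [Finset.sum_filter]
    rw [(Finset.mem_filter.1 hi).2]
  have h2 : (I.card : ℝ) ^ 2 * D ^ (-s) = ∑ i ∈ I, ∑ j ∈ I, D ^ (-s) := by
    simp; ring
  rw [h1, h2, ← Finset.sum_add_distrib]
  refine Finset.sum_le_sum fun i hi => ?_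
  rw [← Finset.sum_add_distrib]
  refine Finset.sum_le_sum fun j hj => ?_
  have hp : 0 ≤ D ^ (-s) := by positivity
  by_cases hc : c j = c i
  · simp only [hc, if_true]; linarith
  · have hij : i ≠ j := fun e => hc (by rw [e])
    simp only [hc, hij, if_false, zero_add]
    exact Real.rpow_le_rpow_of_nonpos hD (h i hi j hj (Ne.symm hc)) (by linarith)

/-- Points with a close neighbour contribute a lot of energy. -/
theorem card_close_mul_le_energy (hs : 0 ≤ s) {I J : Finset ι} {x : ι → E}
    (hx : ∀ i ∈ I, ∀ j ∈ I, i ≠ j → x i ≠ x j) (hJ : J ⊆ I) {ρ : ℝ}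
    (hclose : ∀ i ∈ J, ∃ j ∈ I, i ≠ j ∧ dist (x i) (x j) < ρ) :
    (J.card : ℝ) * ρ ^ (-s) ≤ energy s I x := by
  rw [← nsmul_eq_mul, ← Finset.sum_const]
  refine (Finset.sum_le_sum (fun i hi => ?_)).trans
    (Finset.sum_le_sum_of_subset_of_nonneg hJ fun _ _ _ =>
      Finset.sum_nonneg fun _ _ => energy_term_nonneg x _ _)
  obtain ⟨j, hj, hij, hd⟩ := hclose i hi
  calc ρ ^ (-s) ≤ dist (x i) (x j) ^ (-s) :=
        Real.rpow_le_rpow_of_nonpos (dist_pos.2 (hx i (hJ hi) j hj hij)) hd.le (by linarith)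
    _ = if i = j then (0 : ℝ) else dist (x i) (x j) ^ (-s) := by simp [hij]
    _ ≤ _ := Finset.single_le_sum
          (f := fun j => if i = j then (0 : ℝ) else dist (x i) (x j) ^ (-s))
          (fun _ _ => energy_term_nonneg x _ _) hj

theorem rieszEnergy_eq_ofReal (ω : Finset E) :
    rieszEnergy s ω = ENNReal.ofReal (energy s ω id) := by
  unfold rieszEnergy energy
  rw [ENNReal.ofReal_sum_of_nonneg fun _ _ => Finset.sum_nonneg fun _ _ =>
    energy_term_nonneg _ _ _]
  refine Finset.sum_congr rfl fun x _ => ?_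
  rw [ENNReal.ofReal_sum_of_nonneg fun _ _ => energy_term_nonneg _ _ _]
  refine Finset.sum_congr rfl fun y _ => ?_
  split_ifs with h
  · simp
  · rw [edist_dist, ENNReal.ofReal_rpow_of_pos (dist_pos.2 h)]; rfl

end Energy

section Cells

variable {d : ℕ}

/-- The index of the cell of the grid of mesh `t` containing `x`. -/
noncomputable def cell (t : ℝ) (x : EuclideanSpace ℝ (Fin d)) : Fin d → ℤ := fun i => ⌊x i / t⌋

/-- The integer point with coordinates `k`. -/
noncomputable def intPoint (k : Fin d → ℤ) : EuclideanSpace ℝ (Fin d) :=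
  WithLp.toLp 2 fun i => (k i : ℝ)

theorem intPoint_apply (k : Fin d → ℤ) (i : Fin d) : intPoint k i = (k i : ℝ) := rfl

theorem mem_cell_iff {t : ℝ} (ht : 0 < t) (k : Fin d → ℤ) (x : EuclideanSpace ℝ (Fin d)) :
    cell t x = k ↔ ∀ i, x i ∈ Set.Ico (t * k i) (t * (k i + 1)) := by
  unfold cell
  rw [funext_iff]
  refine forall_congr' fun i => ?_
  rw [Int.floor_eq_iff, le_div_iff₀ ht, div_lt_iff₀ ht, mul_comm t, mul_comm t]
  rfl

theorem cell_preimage_eq {t : ℝ} (ht : 0 < t) (k : Fin d → ℤ) :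
    (cell t ⁻¹' {k} : Set (EuclideanSpace ℝ (Fin d))) =
      WithLp.ofLp ⁻¹' (Set.pi univ fun i => Set.Ico (t * k i) (t * (k i + 1))) := by
  ext x
  simp only [Set.mem_preimage, Set.mem_singleton_iff, mem_cell_iff ht, Set.mem_pi, Set.mem_univ,
    true_implies]

theorem measurableSet_cell {t : ℝ} (ht : 0 < t) (k : Fin d → ℤ) :
    MeasurableSet (cell t ⁻¹' {k} : Set (EuclideanSpace ℝ (Fin d))) := by
  rw [cell_preimage_eq ht]
  exact (PiLp.volume_preserving_ofLp (Fin d)).measurable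
    (MeasurableSet.univ_pi fun _ => measurableSet_Ico)

theorem volume_cell {t : ℝ} (ht : 0 < t) (k : Fin d → ℤ) :
    volume (cell t ⁻¹' {k} : Set (EuclideanSpace ℝ (Fin d))) = ENNReal.ofReal (t ^ d) := by
  rw [cell_preimage_eq ht, (PiLp.volume_preserving_ofLp (Fin d)).measure_preimage
    (MeasurableSet.univ_pi fun _ => measurableSet_Ico).nullMeasurableSet, Real.volume_pi_Ico]
  simp_rw [← mul_sub, add_sub_cancel_left, mul_one]
  simp [ENNReal.ofReal_pow ht.le]

theorem volume_real_cell {t : ℝ} (ht : 0 < t) (k : Fin d → ℤ) :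
    volume.real (cell t ⁻¹' {k} : Set (EuclideanSpace ℝ (Fin d))) = t ^ d := by
  rw [measureReal_def, volume_cell ht, ENNReal.toReal_ofReal (by positivity)]

theorem abs_apply_sub_le_dist (x y : EuclideanSpace ℝ (Fin d)) (i : Fin d) :
    |x i - y i| ≤ dist x y := by
  rw [dist_eq_norm]
  simpa using PiLp.norm_apply_le (x - y) i

theorem dist_le_sqrt_mul {x y : EuclideanSpace ℝ (Fin d)} {r : ℝ} (hr : 0 ≤ r)
    (h : ∀ i, |x i - y i| ≤ r) : dist x y ≤ √d * r := by
  rw [EuclideanSpace.dist_eq]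
  calc √(∑ i, dist (x i) (y i) ^ 2) ≤ √(∑ _i : Fin d, r ^ 2) := by
        refine Real.sqrt_le_sqrt (Finset.sum_le_sum fun i _ => ?_)
        rw [Real.dist_eq]
        exact pow_le_pow_left₀ (abs_nonneg _) (h i) 2
    _ = √d * r := by
        rw [Finset.sum_const, Finset.card_univ, Fintype.card_fin, nsmul_eq_mul,
          Real.sqrt_mul (by positivity), Real.sqrt_sq hr]

theorem dist_le_of_cell_eq {t : ℝ} (ht : 0 < t) {x y : EuclideanSpace ℝ (Fin d)}
    (h : cell t x = cell t y) : dist x y ≤ √d * t := by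
  refine dist_le_sqrt_mul ht.le fun i => ?_
  have hx := (mem_cell_iff ht (cell t y) x).1 h i
  have hy := (mem_cell_iff ht (cell t y) y).1 rfl i
  rw [abs_le]
  constructor <;> nlinarith [hx.1, hx.2, hy.1, hy.2]

theorem card_cells_mul_le {t : ℝ} (ht : 0 < t) {K : Set (EuclideanSpace ℝ (Fin d))}
    (hK : IsCompact K) {T : Finset (Fin d → ℤ)} (hT : ↑T ⊆ cell t '' K) :
    (T.card : ℝ) * t ^ d ≤ volume.real (cthickening (√d * t) K) := by
  have hfin : volume (cthickening (√d * t) K) ≠ ∞ := hK.isBounded.cthickening.measure_lt_top.ne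
  calc (T.card : ℝ) * t ^ d
      = ∑ k ∈ T, volume.real (cell t ⁻¹' {k} : Set (EuclideanSpace ℝ (Fin d))) := by
        simp [volume_real_cell ht]
    _ = volume.real (⋃ k ∈ T, (cell t ⁻¹' {k} : Set (EuclideanSpace ℝ (Fin d)))) := by
        rw [measureReal_biUnion_finset (h := fun k _ => by
          rw [volume_cell ht]; exact ENNReal.ofReal_ne_top)]
        · intro a _ b _ hab
          exact Disjoint.preimage _ (by simpa using hab)
        · exact fun k _ => measurableSet_cell ht k
    _ ≤ _ := by
        refine measureReal_mono (Set.iUnion₂_subset fun k hk x hx => ?_) hfin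
        obtain ⟨y, hy, rfl⟩ := hT hk
        exact mem_cthickening_of_dist_le x y _ _ hy (dist_le_of_cell_eq ht hx)

theorem finite_cells {t : ℝ} (ht : 0 < t) {K : Set (EuclideanSpace ℝ (Fin d))}
    (hK : IsCompact K) : (cell t '' K).Finite := by
  by_contra hinf
  obtain ⟨n, hn⟩ := exists_nat_gt (volume.real (cthickening (√d * t) K) / t ^ d)
  obtain ⟨T, hT, hcard⟩ := Set.Infinite.exists_subset_card_eq hinf n
  have := card_cells_mul_le ht hK hT
  rw [div_lt_iff₀ (by positivity)] at hn
  rw [hcard] at this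
  linarith

theorem volume_le_card_cells_mul {t : ℝ} (ht : 0 < t) {K : Set (EuclideanSpace ℝ (Fin d))}
    {T : Finset (Fin d → ℤ)} (hT : cell t '' K ⊆ ↑T) :
    volume.real K ≤ (T.card : ℝ) * t ^ d := by
  calc volume.real K
      ≤ volume.real (⋃ k ∈ T, (cell t ⁻¹' {k} : Set (EuclideanSpace ℝ (Fin d)))) := by
        refine measureReal_mono (fun x hx => ?_) ?_
        · exact Set.mem_iUnion₂.2 ⟨cell t x, hT ⟨x, hx, rfl⟩, rfl⟩
        · refine ((measure_biUnion_finset_le _ _).trans_lt ?_).ne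
          simp [volume_cell ht, ENNReal.mul_lt_top_iff]
    _ ≤ ∑ k ∈ T, volume.real (cell t ⁻¹' {k} : Set (EuclideanSpace ℝ (Fin d))) :=
        measureReal_biUnion_finset_le _ _
    _ = _ := by simp [volume_real_cell ht]

/-- The volume of the unit ball of `ℝ^d`. -/
noncomputable def ballVolume (d : ℕ) : ℝ := volume.real (ball (0 : EuclideanSpace ℝ (Fin d)) 1)

theorem ballVolume_pos : 0 < ballVolume d :=
  ENNReal.toReal_pos (measure_ball_pos _ _ one_pos).ne' measure_ball_lt_top.ne

theorem volume_real_ball (x : EuclideanSpace ℝ (Fin d)) {r : ℝ} (hr : 0 < r) :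
    volume.real (ball x r) = ballVolume d * r ^ d := by
  have := Measure.addHaar_ball_mul_of_pos (volume : Measure (EuclideanSpace ℝ (Fin d))) x hr 1
  rw [mul_one] at this
  rw [measureReal_def, this, ENNReal.toReal_mul, ENNReal.toReal_ofReal (by positivity),
    finrank_euclideanSpace_fin, mul_comm]
  rfl

/-- Packing bound: disjoint balls of radius `r` inside a set of finite volume. -/
theorem card_mul_le_of_separated {ι : Type*} {I : Finset ι} {x : ι → EuclideanSpace ℝ (Fin d)}
    {r : ℝ} (hr : 0 < r) {S : Set (EuclideanSpace ℝ (Fin d))} (hS : volume S ≠ ∞)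
    (hsep : ∀ i ∈ I, ∀ j ∈ I, i ≠ j → 2 * r ≤ dist (x i) (x j))
    (hsub : ∀ i ∈ I, ball (x i) r ⊆ S) :
    (I.card : ℝ) * (ballVolume d * r ^ d) ≤ volume.real S := by
  calc (I.card : ℝ) * (ballVolume d * r ^ d)
      = ∑ i ∈ I, volume.real (ball (x i) r) := by
        simp [volume_real_ball _ hr]
    _ = volume.real (⋃ i ∈ I, ball (x i) r) := by
        rw [measureReal_biUnion_finset]
        · intro a ha b hb hab
          exact ball_disjoint_ball (by linarith [hsep a ha b hb hab])
        · exact fun k _ => measurableSet_ball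
    _ ≤ _ := measureReal_mono (Set.iUnion₂_subset hsub) hS

theorem tendsto_volume_cthickening {K : Set (EuclideanSpace ℝ (Fin d))} (hK : IsCompact K)
    (b : ℝ) :
    Tendsto (fun t : ℝ => volume.real (cthickening (b * t) K)) (𝓝[>] 0) (𝓝 (volume.real K)) := by
  have h1 : Tendsto (fun t : ℝ => b * t) (𝓝[>] 0) (𝓝 0) := by
    have : Tendsto (fun t : ℝ => b * t) (𝓝 0) (𝓝 (b * 0)) := tendsto_id.const_mul b
    rw [mul_zero] at this
    exact this.mono_left nhdsWithin_le_nhds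
  exact (ENNReal.tendsto_toReal hK.measure_lt_top.ne).comp
    ((tendsto_measure_cthickening_of_isCompact hK).comp h1)

theorem isCompact_unitCube : IsCompact (unitCube d) := by
  have : unitCube d = (EuclideanSpace.equiv (Fin d) ℝ) ⁻¹'
      (Set.pi univ fun _ => Set.Icc (0 : ℝ) 1) := by
    ext x; exact ⟨fun h i _ => h i, fun h i => h i (Set.mem_univ i)⟩
  rw [this]
  exact (EuclideanSpace.equiv (Fin d) ℝ).toHomeomorph.isCompact_preimage.2
    (isCompact_univ_pi fun _ => isCompact_Icc)

theorem volume_unitCube : volume (unitCube d) = 1 := by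
  have : unitCube d = WithLp.ofLp ⁻¹' (Set.Icc (0 : Fin d → ℝ) 1) := by
    ext x; simp [unitCube, Set.mem_Icc, Pi.le_def, forall_and]
  rw [this, (PiLp.volume_preserving_ofLp (Fin d)).measure_preimage
    measurableSet_Icc.nullMeasurableSet, Real.volume_Icc_pi]
  simp

end Cells

section LowerConst

variable {d : ℕ} {s : ℝ}

/-- `a` is an asymptotic lower bound for the normalized `s`-energy of configurations in the unit
cube. -/
def IsLowerConst (d : ℕ) (s a : ℝ) : Prop :=
  ∃ b : ℝ, 0 ≤ b ∧ ∀ ω : Finset (EuclideanSpace ℝ (Fin d)), ↑ω ⊆ unitCube d →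
    a * (ω.card : ℝ) ^ (1 + s / d) ≤ energy s ω id + b

theorem rpow_inv_pow (hd : 1 ≤ d) {q : ℝ} (hq : 0 ≤ q) : (q ^ (1 / (d : ℝ))) ^ d = q := by
  rw [one_div]
  exact Real.rpow_inv_natCast_pow hq (by omega)

theorem rpow_inv_rpow {q : ℝ} (hq : 0 ≤ q) (s : ℝ) :
    (q ^ (1 / (d : ℝ))) ^ (-s) = q ^ (-(s / d)) := by
  rw [← Real.rpow_mul hq]
  congr 1
  ring

theorem exists_isLowerConst_pos (hd : 1 ≤ d) (hs : 0 ≤ s) : ∃ a, 0 < a ∧ IsLowerConst d s a := by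
  set V := volume.real (cthickening 1 (unitCube d)) with hV
  have hfin : volume (cthickening 1 (unitCube d)) ≠ ∞ :=
    isCompact_unitCube.isBounded.cthickening.measure_lt_top.ne
  have hV1 : 1 ≤ V := by
    have h : volume.real (unitCube d) = 1 := by simp [measureReal_def, volume_unitCube]
    rw [← h]
    exact measureReal_mono (self_subset_cthickening _) hfin
  have hv := ballVolume_pos (d := d)
  set Q := 2 ^ (d + 1) * V / ballVolume d with hQ
  have hQ0 : 0 < Q := by positivity
  refine ⟨Q ^ (-(s / d)) / 2, by positivity, Q ^ (-(s / d)) / 2 * Q ^ (1 + s / d), by positivity,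
    fun ω hω => ?_⟩
  set n : ℝ := (ω.card : ℝ) with hn
  have hsd : 0 ≤ s / d := by positivity
  by_cases hnQ : n ≤ Q
  · have h1 : n ^ (1 + s / d) ≤ Q ^ (1 + s / d) :=
      Real.rpow_le_rpow (by positivity) hnQ (by linarith)
    have h2 := energy_nonneg (s := s) ω id
    have h3 : 0 ≤ Q ^ (-(s / d)) / 2 := by positivity
    nlinarith
  push Not at hnQ
  have hn0 : 0 < n := hQ0.trans hnQ
  set ρ := (Q / n) ^ (1 / (d : ℝ)) with hρ
  have hρ0 : 0 < ρ := by positivity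
  have hρd : ρ ^ d = Q / n := rpow_inv_pow hd (by positivity)
  have hρ1 : ρ ≤ 1 :=
    Real.rpow_le_one (by positivity) ((div_le_one hn0).2 hnQ.le) (by positivity)
  have hinj : ∀ i ∈ ω, ∀ j ∈ ω, i ≠ j → id i ≠ id j := fun i _ j _ h => h
  set ωc := ω.filter fun i => ∃ j ∈ ω, i ≠ j ∧ dist (id i) (id j) < ρ with hωc
  set ωf := ω.filter fun i => ¬ ∃ j ∈ ω, i ≠ j ∧ dist (id i) (id j) < ρ with hωf
  have hclose := card_close_mul_le_energy hs hinj (Finset.filter_subset _ _ : ωc ⊆ ω)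
    (ρ := ρ) fun i hi => (Finset.mem_filter.1 hi).2
  have hsum : (ωc.card : ℝ) + ωf.card = n := by
    rw [hn, ← Finset.card_filter_add_card_filter_not (s := ω)
      (fun i => ∃ j ∈ ω, i ≠ j ∧ dist (id i) (id j) < ρ)]
    push_cast; rfl
  have hpack := card_mul_le_of_separated (I := ωf) (x := id) (r := ρ / 2) (by positivity) hfin
    (fun i hi j hj hij => by
      by_contra hlt
      exact (Finset.mem_filter.1 hi).2 ⟨j, (Finset.mem_filter.1 hj).1, hij, by
        push Not at hlt; linarith⟩)
    (fun i hi y hy => mem_cthickening_of_dist_le y i _ _ (hω (Finset.mem_filter.1 hi).1) (by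
      have := mem_ball.1 hy
      simp only [id] at this
      linarith))
  rw [div_pow, hρd] at hpack
  have hfc : (ωf.card : ℝ) ≤ n / 2 := by
    have h1 : ballVolume d * (Q / n / 2 ^ d) = 2 * V / n := by
      rw [hQ, pow_succ]; field_simp
    rw [h1] at hpack
    have h2 : (ωf.card : ℝ) * (2 * V / n) = ωf.card * 2 / n * V := by ring
    rw [h2] at hpack
    have h3 : (ωf.card : ℝ) * 2 / n ≤ 1 := by
      by_contra h; push Not at h; nlinarith
    rw [div_le_one hn0] at h3
    linarith
  have hρs : ρ ^ (-s) = Q ^ (-(s / d)) * n ^ (s / d) := by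
    rw [hρ, rpow_inv_rpow (by positivity), Real.div_rpow hQ0.le hn0.le, Real.rpow_neg hn0.le,
      div_inv_eq_mul]
  have hmain : n / 2 * (Q ^ (-(s / d)) * n ^ (s / d)) ≤ energy s ω id := by
    rw [← hρs]
    refine le_trans ?_ hclose
    gcongr
    linarith
  have h4 : Q ^ (-(s / d)) / 2 * n ^ (1 + s / d) = n / 2 * (Q ^ (-(s / d)) * n ^ (s / d)) := by
    rw [Real.rpow_add hn0, Real.rpow_one]; ring
  rw [h4]
  have : 0 ≤ Q ^ (-(s / d)) / 2 * Q ^ (1 + s / d) := by positivity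
  linarith

/-- Lower bound for the energy of configurations in a compact subset of `ℝ^d`. -/
theorem IsLowerConst.le_energy_of_isCompact {a : ℝ} (ha : IsLowerConst d s a) (ha0 : 0 ≤ a)
    (hd : 1 ≤ d) (hs : 0 ≤ s) {K : Set (EuclideanSpace ℝ (Fin d))} (hK : IsCompact K) {ε : ℝ}
    (hε : 0 < ε) : ∃ b : ℝ, 0 ≤ b ∧ ∀ ω : Finset (EuclideanSpace ℝ (Fin d)), ↑ω ⊆ K →
      a * (ω.card : ℝ) ^ (1 + s / d) ≤ (volume.real K + ε) ^ (s / d) * energy s ω id + b := by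
  obtain ⟨b, hb, hab⟩ := ha
  have hsd : 0 ≤ s / d := by positivity
  obtain ⟨t, htV, ht⟩ := (((tendsto_volume_cthickening hK (√d)).eventually_lt_const
    (by linarith : volume.real K < volume.real K + ε)).and self_mem_nhdsWithin).exists
  replace ht : 0 < t := ht
  set T := (finite_cells ht hK).toFinset with hT
  have hTK : ↑T = cell t '' K := by simp [hT]
  set M : ℝ := (T.card : ℝ) with hM
  have hMt : M * t ^ d ≤ volume.real K + ε := (card_cells_mul_le ht hK hTK.le).trans htV.le
  refine ⟨M ^ (s / d) * (M * b), by positivity, fun ω hω => ?_⟩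
  have hmaps : ∀ x ∈ ω, cell t x ∈ T := fun x hx => by
    rw [← Finset.mem_coe, hTK]; exact ⟨x, hω hx, rfl⟩
  have hcellle : ∀ k ∈ T, a * ((ω.filter fun x => cell t x = k).card : ℝ) ^ (1 + s / d) ≤
      t ^ s * energy s (ω.filter fun x => cell t x = k) id + b := by
    intro k _
    set ωk := ω.filter fun x => cell t x = k with hωk
    set y : EuclideanSpace ℝ (Fin d) → EuclideanSpace ℝ (Fin d) :=
      fun x => t⁻¹ • x - intPoint k with hy
    have hdist : ∀ x x', dist (y x) (y x') = t⁻¹ * dist x x' := by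
      intro x x'
      simp only [hy, dist_sub_right, dist_smul₀, Real.norm_eq_abs, abs_of_pos (inv_pos.2 ht)]
    have hyinj : Set.InjOn y ωk := by
      intro x _ x' _ h
      have h1 := hdist x x'
      rw [h, dist_self] at h1
      have h2 : dist x x' = 0 := by
        rcases mul_eq_zero.1 h1.symm with h | h
        · exact absurd h (inv_pos.2 ht).ne'
        · exact h
      exact dist_eq_zero.1 h2
    have h1 := hab (ωk.image y) (by
      intro z hz
      obtain ⟨x, hx, rfl⟩ := Finset.mem_image.1 (Finset.mem_coe.1 hz)
      intro i
      have h2 := (mem_cell_iff ht k x).1 (Finset.mem_filter.1 hx).2 i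
      have h3 : y x i = x i / t - k i := by
        simp [hy, intPoint_apply, div_eq_inv_mul]
      have h4 : (k i : ℝ) ≤ x i / t := by rw [le_div_iff₀ ht, mul_comm]; exact h2.1
      have h5 : x i / t ≤ k i + 1 := by rw [div_le_iff₀ ht, mul_comm]; exact h2.2.le
      rw [h3]
      constructor <;> linarith)
    rw [Finset.card_image_of_injOn hyinj, energy_image hyinj] at h1
    refine h1.trans ?_
    have h2 := energy_le_of_dist_le (s := s) hs (inv_pos.2 ht) (I := ωk) (x := id) (y := y)
      (fun _ _ _ _ h => h) (fun i _ j _ _ => (hdist i j).ge)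
    rw [Real.inv_rpow ht.le, Real.rpow_neg ht.le, inv_inv] at h2
    linarith
  have hsumle : a * ∑ k ∈ T, ((ω.filter fun x => cell t x = k).card : ℝ) ^ (1 + s / d) ≤
      t ^ s * energy s ω id + M * b := by
    rw [Finset.mul_sum]
    refine (Finset.sum_le_sum hcellle).trans ?_
    rw [Finset.sum_add_distrib, ← Finset.mul_sum, Finset.sum_const, nsmul_eq_mul]
    have := sum_energy_fiber_le (s := s) ω id (cell t) T
    gcongr
  have hcard : (ω.card : ℝ) = ∑ k ∈ T, ((ω.filter fun x => cell t x = k).card : ℝ) := by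
    rw [Finset.card_eq_sum_card_fiberwise hmaps]; push_cast; rfl
  have hpow := Real.rpow_sum_le_const_mul_sum_rpow_of_nonneg T
    (f := fun k => ((ω.filter fun x => cell t x = k).card : ℝ)) (p := 1 + s / d) (by linarith)
    (fun _ _ => by positivity)
  rw [← hcard, add_sub_cancel_left] at hpow
  have hMts : M ^ (s / d) * t ^ s ≤ (volume.real K + ε) ^ (s / d) := by
    have : t ^ s = (t ^ d) ^ (s / d) := by
      rw [← Real.rpow_natCast, ← Real.rpow_mul ht.le]
      congr 1
      have : (d : ℝ) ≠ 0 := by positivity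
      field_simp
    rw [this, ← Real.mul_rpow (by positivity) (by positivity)]
    exact Real.rpow_le_rpow (by positivity) hMt hsd
  calc a * (ω.card : ℝ) ^ (1 + s / d)
      ≤ a * (M ^ (s / d) * ∑ k ∈ T, ((ω.filter fun x => cell t x = k).card : ℝ) ^ (1 + s / d)) := by
        gcongr
    _ = M ^ (s / d) * (a * ∑ k ∈ T, ((ω.filter fun x => cell t x = k).card : ℝ) ^ (1 + s / d)) := by
        ring
    _ ≤ M ^ (s / d) * (t ^ s * energy s ω id + M * b) := by gcongr
    _ = (M ^ (s / d) * t ^ s) * energy s ω id + M ^ (s / d) * (M * b) := by ring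
    _ ≤ _ := by
        have := energy_nonneg (s := s) ω id
        gcongr

/-- Lower bound for the energy of configurations in a set that maps to a compact subset of `ℝ^d`
without contracting distances too much. -/
theorem IsLowerConst.le_energy_of_dist_le {X : Type*} [MetricSpace X] {a : ℝ}
    (ha : IsLowerConst d s a) (ha0 : 0 ≤ a) (hd : 1 ≤ d) (hs : 0 ≤ s) {B : Set X}
    {g : X → EuclideanSpace ℝ (Fin d)} {c : ℝ} (hc : 0 < c)
    (hg : ∀ x ∈ B, ∀ y ∈ B, dist x y ≤ c * dist (g x) (g y)) (hK : IsCompact (g '' B))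
    {ε : ℝ} (hε : 0 < ε) : ∃ b : ℝ, 0 ≤ b ∧ ∀ ω : Finset X, ↑ω ⊆ B →
      a * (ω.card : ℝ) ^ (1 + s / d) ≤
        (volume.real (g '' B) + ε) ^ (s / d) * (c ^ s * energy s ω id) + b := by
  obtain ⟨b, hb, h⟩ := ha.le_energy_of_isCompact ha0 hd hs hK hε
  refine ⟨b, hb, fun ω hω => ?_⟩
  have hinj : Set.InjOn g ω := by
    intro x hx y hy hxy
    have := hg x (hω hx) y (hω hy)
    rw [hxy, dist_self, mul_zero] at this
    exact dist_le_zero.1 this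
  have h1 := h (ω.image g) (by
    rw [Finset.coe_image]; exact Set.image_mono hω)
  rw [Finset.card_image_of_injOn hinj, energy_image hinj] at h1
  refine h1.trans ?_
  have h2 := energy_le_of_dist_le (s := s) hs (inv_pos.2 hc) (I := ω) (x := id) (y := g)
    (fun _ _ _ _ h => h) (fun i hi j hj _ => by
      rw [inv_mul_le_iff₀ hc]; exact hg i (hω hi) j (hω hj))
  rw [Real.inv_rpow hc.le, Real.rpow_neg hc.le, inv_inv] at h2
  gcongr

end LowerConst

section Periodic

variable {d : ℕ} {s : ℝ}

theorem intPoint_sub (k l : Fin d → ℤ) : intPoint k - intPoint l = intPoint (k - l) := by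
  ext i; simp [intPoint_apply]

theorem intPoint_injective : Function.Injective (intPoint (d := d)) := by
  intro k l h
  ext i
  have := congrArg (fun x : EuclideanSpace ℝ (Fin d) => x i) h
  simpa [intPoint_apply] using this

theorem exists_lattice_sum_le (hd : 1 ≤ d) (hs : (d : ℝ) < s) :
    ∃ S : ℝ, 0 ≤ S ∧ ∀ (k : Fin d → ℤ) (T : Finset (Fin d → ℤ)),
      ∑ l ∈ T, (if k = l then 0 else dist (intPoint k) (intPoint l) ^ (-s)) ≤ S := by
  set b := (EuclideanSpace.basisFun (Fin d) ℝ).toBasis with hb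
  set L : Submodule ℤ (EuclideanSpace ℝ (Fin d)) := Submodule.span ℤ (Set.range b) with hL
  have hrank : Module.finrank ℤ L = d := by
    rw [ZLattice.rank ℝ L, finrank_euclideanSpace_fin]
  have hmem : ∀ k : Fin d → ℤ, intPoint k ∈ L := by
    intro k
    rw [hL, Module.Basis.mem_span_iff_repr_mem]
    intro i
    exact ⟨k i, by simp [hb, intPoint_apply]⟩
  have h0 : 0 ≤ ZLattice.tsumNormRPowBound L ^ (-s) *
      ∑' k : ℕ, (k : ℝ) ^ ((Module.finrank ℤ L : ℝ) - 1 + -s) := by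
    have := ZLattice.tsumNormRPowBound_spec L (-s) (by rw [hrank]; linarith) ∅
    simpa using this
  refine ⟨_, h0, fun k T => ?_⟩
  have hinj : Function.Injective (fun l : Fin d → ℤ => (⟨intPoint (k - l), hmem _⟩ : L)) := by
    intro l l' h
    have := intPoint_injective (Subtype.mk.inj h)
    simpa using this
  have h1 := ZLattice.tsumNormRPowBound_spec L (-s) (by rw [hrank]; linarith)
    (T.map ⟨_, hinj⟩)
  refine le_trans (le_of_eq ?_) h1
  rw [Finset.sum_map]
  refine Finset.sum_congr rfl fun l _ => ?_
  have hs0 : -s ≠ 0 := by have : (0 : ℝ) ≤ d := by positivity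
                          intro h; linarith
  split_ifs with h
  · have h2 : intPoint (k - l) = 0 := by rw [← intPoint_sub, h, sub_self]
    simp only [Function.Embedding.coeFn_mk, Submodule.coe_norm, h2, norm_zero]
    rw [Real.zero_rpow hs0]
  · simp only [Function.Embedding.coeFn_mk, Submodule.coe_norm, dist_eq_norm, intPoint_sub]

theorem mul_dist_intPoint_le (hd : 1 ≤ d) {γ : ℝ} (hγ : γ < 1)
    {y y' : EuclideanSpace ℝ (Fin d)} (hy : ∀ i, y i ∈ Set.Icc 0 γ)
    (hy' : ∀ i, y' i ∈ Set.Icc 0 γ) {k l : Fin d → ℤ} (hkl : k ≠ l) :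
    (1 - γ) / √d * dist (intPoint k) (intPoint l) ≤ dist (y + intPoint k) (y' + intPoint l) := by
  have : Nonempty (Fin d) := ⟨⟨0, hd⟩⟩
  obtain ⟨i, -, hi⟩ := Finset.exists_max_image Finset.univ (fun i => |(k i : ℝ) - l i|)
    Finset.univ_nonempty
  set m := |(k i : ℝ) - l i| with hm
  have hd0 : 0 < √(d : ℝ) := by
    have : (0 : ℝ) < d := by exact_mod_cast hd
    positivity
  have h1 : dist (intPoint k) (intPoint l) ≤ √d * m :=
    dist_le_sqrt_mul (abs_nonneg _) fun j => hi j (Finset.mem_univ j)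
  have hm1 : 1 ≤ m := by
    obtain ⟨j, hj⟩ := Function.ne_iff.1 hkl
    have h2 : (1 : ℝ) ≤ |(k j : ℝ) - l j| := by
      have : (1 : ℤ) ≤ |k j - l j| := Int.one_le_abs (sub_ne_zero.2 hj)
      exact_mod_cast this
    exact h2.trans (hi j (Finset.mem_univ j))
  have h3 : m - γ ≤ dist (y + intPoint k) (y' + intPoint l) := by
    refine le_trans ?_ (abs_apply_sub_le_dist _ _ i)
    have h4 : (y + intPoint k) i - (y' + intPoint l) i = (y i - y' i) + ((k i : ℝ) - l i) := by
      simp [intPoint_apply]; ring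
    rw [h4]
    have h5 : |y i - y' i| ≤ γ := by
      rw [abs_le]; constructor <;> linarith [(hy i).1, (hy i).2, (hy' i).1, (hy' i).2]
    have h6 := abs_sub_abs_le_abs_sub ((k i : ℝ) - l i) (-(y i - y' i))
    rw [abs_neg, sub_neg_eq_add, add_comm ((k i : ℝ) - l i)] at h6
    linarith
  have hγ0 : 0 ≤ γ := (hy i).1.trans (hy i).2
  calc (1 - γ) / √d * dist (intPoint k) (intPoint l) ≤ (1 - γ) / √d * (√d * m) := by
        have : 0 ≤ (1 - γ) / √d := div_nonneg (by linarith) hd0.le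
        gcongr
    _ = (1 - γ) * m := by field_simp
    _ ≤ m - γ := by nlinarith
    _ ≤ _ := h3

/-- If `c` is not a lower constant, then there is a configuration in the half-open unit cube whose
periodic extension has normalized energy per cell below any `c' > c`. -/
theorem exists_periodic (hd : 1 ≤ d) (hs : (d : ℝ) < s) {c c' : ℝ} (hc0 : 0 ≤ c)
    (hc : ¬ IsLowerConst d s c) (hcc : c < c') :
    ∃ Y : Finset (EuclideanSpace ℝ (Fin d)), 0 < Y.card ∧ (∀ y ∈ Y, ∀ i, y i ∈ Set.Ico 0 1) ∧
      ∀ T : Finset (Fin d → ℤ), energy s (Y ×ˢ T) (fun q => q.1 + intPoint q.2) ≤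
        T.card * (c' * (Y.card : ℝ) ^ (1 + s / d)) := by
  have hd0 : (0 : ℝ) < d := by exact_mod_cast hd
  have hs0 : 0 < s := hd0.trans hs
  have hp : 1 < s / d := (one_lt_div hd0).2 hs
  obtain ⟨S, hS0, hS⟩ := exists_lattice_sum_le hd hs
  obtain ⟨γ, hγc, hγ1, hγ0⟩ : ∃ γ : ℝ, γ ^ (-s) * c < (c + c') / 2 ∧ γ < 1 ∧ 0 < γ := by
    have h1 : Tendsto (fun γ : ℝ => γ ^ (-s) * c) (𝓝[<] 1) (𝓝 ((1 : ℝ) ^ (-s) * c)) :=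
      (((Real.continuousAt_rpow_const 1 (-s) (Or.inl one_ne_zero)).tendsto).mul_const c).mono_left
        nhdsWithin_le_nhds
    rw [Real.one_rpow, one_mul] at h1
    have h2 := h1.eventually_lt_const (by linarith : c < (c + c') / 2)
    have h3 : ∀ᶠ γ : ℝ in 𝓝[<] 1, 0 < γ :=
      (lt_mem_nhds one_pos).filter_mono nhdsWithin_le_nhds
    have h4 : ∀ᶠ γ : ℝ in 𝓝[<] 1, γ < 1 := self_mem_nhdsWithin
    obtain ⟨γ, h⟩ := (h2.and (h4.and h3)).exists
    exact ⟨γ, h⟩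
  set D := ((1 - γ) / √d) ^ (-s) * S with hD
  have hsq : 0 < √(d : ℝ) := Real.sqrt_pos.2 hd0
  have hγd : 0 < (1 - γ) / √d := div_pos (by linarith) hsq
  have hD0 : 0 ≤ D := by positivity
  obtain ⟨n₀, hn₀⟩ : ∃ n₀ : ℝ, 0 < n₀ ∧ ∀ n ≥ n₀, n ^ (2 : ℕ) * D ≤
      (c' - c) / 2 * n ^ (1 + s / d) := by
    have h1 : Tendsto (fun n : ℝ => D * n ^ (-(s / d - 1))) atTop (𝓝 (D * 0)) :=
      (tendsto_rpow_neg_atTop (by linarith)).const_mul D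
    rw [mul_zero] at h1
    obtain ⟨n₀, h2⟩ := eventually_atTop.1
      (h1.eventually_le_const (by linarith : (0 : ℝ) < (c' - c) / 2))
    refine ⟨max n₀ 1, by positivity, fun n hn => ?_⟩
    have hn1 : 0 < n := lt_of_lt_of_le one_pos ((le_max_right _ _).trans hn)
    have h3 := h2 n ((le_max_left _ _).trans hn)
    have h4 : n ^ (2 : ℕ) = n ^ (-(s / d - 1)) * n ^ (1 + s / d) := by
      rw [← Real.rpow_add hn1, ← Real.rpow_natCast]
      congr 1
      push_cast; ring
    rw [h4]
    calc n ^ (-(s / d - 1)) * n ^ (1 + s / d) * D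
        = D * n ^ (-(s / d - 1)) * n ^ (1 + s / d) := by ring
      _ ≤ _ := by gcongr
  unfold IsLowerConst at hc
  push Not at hc
  obtain ⟨ω, hω, hωE⟩ := hc (c * n₀ ^ (1 + s / d)) (by have := hn₀.1; positivity)
  have hEω := energy_nonneg (s := s) ω id
  have hcard : n₀ < ω.card := by
    by_contra h
    push Not at h
    have : (ω.card : ℝ) ^ (1 + s / d) ≤ n₀ ^ (1 + s / d) :=
      Real.rpow_le_rpow (by positivity) h (by linarith)
    nlinarith
  have hinj : Function.Injective (fun x : EuclideanSpace ℝ (Fin d) => γ • x) :=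
    smul_right_injective _ hγ0.ne'
  set Y := ω.image fun x => γ • x with hY
  have hYcard : Y.card = ω.card := Finset.card_image_of_injective _ hinj
  have hYγ : ∀ y ∈ Y, ∀ i, y i ∈ Set.Icc 0 γ := by
    intro y hy i
    obtain ⟨x, hx, rfl⟩ := Finset.mem_image.1 hy
    have := hω hx i
    simp only [PiLp.smul_apply, smul_eq_mul]
    constructor <;> nlinarith [this.1, this.2]
  have hYE : energy s Y id ≤ γ ^ (-s) * energy s ω id := by
    rw [hY, energy_image hinj.injOn]
    refine energy_le_of_dist_le hs0.le hγ0 (fun _ _ _ _ h => h) fun i _ j _ _ => ?_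
    simp [dist_smul₀, abs_of_pos hγ0]
  refine ⟨Y, ?_, fun y hy i => ⟨(hYγ y hy i).1, (hYγ y hy i).2.trans_lt hγ1⟩, fun T => ?_⟩
  · rw [hYcard]
    have : (0 : ℝ) < ω.card := hn₀.1.trans hcard
    exact_mod_cast this
  have hterm : ∀ q ∈ Y ×ˢ T, ∀ q' ∈ Y ×ˢ T,
      (if q = q' then (0 : ℝ) else dist (q.1 + intPoint q.2) (q'.1 + intPoint q'.2) ^ (-s)) ≤
      (if q.2 = q'.2 then (if q.1 = q'.1 then 0 else dist q.1 q'.1 ^ (-s)) else 0) +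
        ((1 - γ) / √d) ^ (-s) *
          (if q.2 = q'.2 then 0 else dist (intPoint q.2) (intPoint q'.2) ^ (-s)) := by
    rintro ⟨y, k⟩ hq ⟨y', l⟩ hq'
    obtain ⟨hy, -⟩ := Finset.mem_product.1 hq
    obtain ⟨hy', -⟩ := Finset.mem_product.1 hq'
    by_cases hkl : k = l
    · subst hkl
      simp [Prod.ext_iff]
    · simp only [Prod.mk.injEq, hkl, and_false, if_false, zero_add]
      rw [← Real.mul_rpow hγd.le dist_nonneg]
      refine Real.rpow_le_rpow_of_nonpos (mul_pos hγd (dist_pos.2 (intPoint_injective.ne hkl)))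
        (mul_dist_intPoint_le hd hγ1 (hYγ y hy) (hYγ y' hy') hkl) (by linarith)
  have hsum : energy s (Y ×ˢ T) (fun q => q.1 + intPoint q.2) ≤
      T.card * energy s Y id + (Y.card : ℝ) ^ 2 * (T.card * D) := by
    unfold energy
    refine (Finset.sum_le_sum fun q hq => Finset.sum_le_sum fun q' hq' =>
      (le_of_eq (by congr!)).trans (hterm q hq q' hq')).trans ?_
    simp_rw [Finset.sum_add_distrib, Finset.sum_product, ← Finset.mul_sum]
    refine add_le_add (le_of_eq ?_) ?_
    · have h1 : ∀ y ∈ Y, ∀ k ∈ T, ∑ y' ∈ Y, ∑ l ∈ T,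
          (if k = l then (if y = y' then (0 : ℝ) else dist y y' ^ (-s)) else 0) =
          ∑ y' ∈ Y, if y = y' then (0 : ℝ) else dist y y' ^ (-s) := by
        intro y _ k hk
        refine Finset.sum_congr rfl fun y' _ => ?_
        rw [Finset.sum_ite_eq, if_pos hk]
      rw [Finset.sum_congr rfl fun y hy => Finset.sum_congr rfl fun k hk => h1 y hy k hk]
      simp [Finset.mul_sum]
    · have h2 : ∀ k ∈ T, ∑ l ∈ T, (if k = l then (0 : ℝ) else
          dist (intPoint k) (intPoint l) ^ (-s)) ≤ S := fun k _ => hS k T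
      simp only [Finset.sum_const, nsmul_eq_mul]
      rw [← Finset.mul_sum]
      have h3 : ∑ k ∈ T, ∑ l ∈ T, (if k = l then (0 : ℝ) else
          dist (intPoint k) (intPoint l) ^ (-s)) ≤ T.card * S := by
        refine (Finset.sum_le_sum h2).trans (le_of_eq ?_)
        simp
      have h4 : (Y.card : ℝ) ^ 2 * (T.card * D) =
          ((1 - γ) / √d) ^ (-s) * (Y.card * (Y.card * (T.card * S))) := by rw [hD]; ring
      rw [h4]
      gcongr
  refine hsum.trans ?_
  have h3 := hn₀.2 ω.card hcard.le
  have h4 : energy s Y id + (Y.card : ℝ) ^ 2 * D ≤ c' * (Y.card : ℝ) ^ (1 + s / d) := by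
    rw [hYcard]
    have h5 : energy s ω id ≤ c * (ω.card : ℝ) ^ (1 + s / d) := by
      have : 0 ≤ c * n₀ ^ (1 + s / d) := by have := hn₀.1; positivity
      linarith
    have h6 : γ ^ (-s) * energy s ω id ≤ (c + c') / 2 * (ω.card : ℝ) ^ (1 + s / d) := by
      calc γ ^ (-s) * energy s ω id ≤ γ ^ (-s) * (c * (ω.card : ℝ) ^ (1 + s / d)) := by gcongr
        _ = (γ ^ (-s) * c) * (ω.card : ℝ) ^ (1 + s / d) := by ring
        _ ≤ _ := by gcongr
    linarith
  calc T.card * energy s Y id + (Y.card : ℝ) ^ 2 * (T.card * D)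
      = T.card * (energy s Y id + (Y.card : ℝ) ^ 2 * D) := by ring
    _ ≤ _ := by gcongr

end Periodic

section Filling

variable {d : ℕ} {s : ℝ}

theorem cell_smul_add_intPoint {t : ℝ} (ht : 0 < t) {y : EuclideanSpace ℝ (Fin d)}
    (hy : ∀ i, y i ∈ Set.Ico (0 : ℝ) 1) (k : Fin d → ℤ) : cell t (t • (y + intPoint k)) = k := by
  rw [mem_cell_iff ht]
  intro i
  simp only [PiLp.smul_apply, PiLp.add_apply, smul_eq_mul, intPoint_apply]
  have := hy i
  constructor
  · nlinarith [this.1]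
  · nlinarith [this.2]

theorem exists_separation {Y : Finset (EuclideanSpace ℝ (Fin d))} (hs : 0 < s)
    (hY : ∀ y ∈ Y, ∀ i, y i ∈ Set.Ico (0 : ℝ) 1) {M : ℝ} (hM : 0 ≤ M)
    (hE : ∀ T : Finset (Fin d → ℤ), energy s (Y ×ˢ T) (fun q => q.1 + intPoint q.2) ≤ T.card * M) :
    ∃ σ : ℝ, 0 < σ ∧ ∀ q q' : EuclideanSpace ℝ (Fin d) × (Fin d → ℤ), q.1 ∈ Y → q'.1 ∈ Y →
      q ≠ q' → σ ≤ dist (q.1 + intPoint q.2) (q'.1 + intPoint q'.2) := by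
  refine ⟨(2 * M + 1) ^ (-(1 / s)), by positivity, fun q q' hq hq' hne => ?_⟩
  have hpos : 0 < dist (q.1 + intPoint q.2) (q'.1 + intPoint q'.2) := by
    refine dist_pos.2 fun h => hne ?_
    have h1 := cell_smul_add_intPoint one_pos (hY _ hq) q.2
    rw [h, cell_smul_add_intPoint one_pos (hY _ hq') q'.2] at h1
    rw [h1] at h
    exact Prod.ext (add_right_cancel h) h1.symm
  have h1 := term_le_energy (s := s) (I := Y ×ˢ {q.2, q'.2}) (fun q => q.1 + intPoint q.2)
    (i := q) (j := q') (by simp [Finset.mem_product, hq]) (by simp [Finset.mem_product, hq']) hne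
  have h2 := h1.trans (hE _)
  have h3 : (({q.2, q'.2} : Finset (Fin d → ℤ)).card : ℝ) ≤ 2 := by
    exact_mod_cast Finset.card_le_two
  by_contra! h
  have h4 := Real.rpow_lt_rpow_of_neg hpos h (neg_lt_zero.2 hs)
  rw [← Real.rpow_mul (by positivity), show -(1 / s) * -s = 1 by field_simp, Real.rpow_one] at h4
  nlinarith

theorem exists_subset_of_periodic (hs : 0 < s) {Y : Finset (EuclideanSpace ℝ (Fin d))}
    (hY : ∀ y ∈ Y, ∀ i, y i ∈ Set.Ico (0 : ℝ) 1) {M : ℝ} (hM : 0 ≤ M)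
    (hE : ∀ T : Finset (Fin d → ℤ), energy s (Y ×ˢ T) (fun q => q.1 + intPoint q.2) ≤ T.card * M)
    {σ : ℝ} (hσ : 0 < σ) (hsep : ∀ q q' : EuclideanSpace ℝ (Fin d) × (Fin d → ℤ), q.1 ∈ Y →
      q'.1 ∈ Y → q ≠ q' → σ ≤ dist (q.1 + intPoint q.2) (q'.1 + intPoint q'.2))
    {γ θ : ℝ} (hγ : 0 < γ) (hθ : 0 < θ) (hθσ : 2 * θ ≤ (1 - γ) * σ)
    {K : Set (EuclideanSpace ℝ (Fin d))} (hK : IsCompact K) {t : ℝ} (ht : 0 < t) :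
    ∃ ω : Finset (EuclideanSpace ℝ (Fin d)), ↑ω ⊆ K ∧
      (ω.card : ℝ) * t ^ d ≤ Y.card * volume.real (cthickening (√d * t) K) ∧
      (Y.card : ℝ) * volume.real K -
        (volume.real (cthickening ((√d + θ) * t) K) - volume.real K) / (ballVolume d * θ ^ d) ≤
          ω.card * t ^ d ∧
      energy s ω id * t ^ ((d : ℝ) + s) ≤ γ ^ (-s) * M * volume.real (cthickening (√d * t) K) := by
  set T : Finset (Fin d → ℤ) := (finite_cells ht hK).toFinset with hT
  have hTK : (T : Set (Fin d → ℤ)) = cell t '' K := by simp [hT]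
  have hT1 := card_cells_mul_le ht hK hTK.subset
  have hT2 := volume_le_card_cells_mul ht hTK.symm.subset
  set P : EuclideanSpace ℝ (Fin d) × (Fin d → ℤ) → EuclideanSpace ℝ (Fin d) :=
    fun q => t • (q.1 + intPoint q.2) with hP
  have hPdist : ∀ q q', dist (P q) (P q') =
      t * dist (q.1 + intPoint q.2) (q'.1 + intPoint q'.2) := by
    intro q q'
    rw [hP, dist_smul₀, Real.norm_of_nonneg ht.le]
  set near : EuclideanSpace ℝ (Fin d) × (Fin d → ℤ) → Prop :=
    fun q => ∃ z ∈ K, dist (P q) z ≤ θ * t with hnear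
  set I := (Y ×ˢ T).filter near with hI
  have hz : ∀ q, ∃ z, near q → z ∈ K ∧ dist (P q) z ≤ θ * t := by
    intro q
    by_cases h : near q
    · obtain ⟨z, h1, h2⟩ := h
      exact ⟨z, fun _ => ⟨h1, h2⟩⟩
    · exact ⟨0, fun h' => (h h').elim⟩
  choose z hz using hz
  have hIz : ∀ q ∈ I, q.1 ∈ Y ∧ z q ∈ K ∧ dist (P q) (z q) ≤ θ * t := by
    intro q hq
    rw [hI, Finset.mem_filter, Finset.mem_product] at hq
    exact ⟨hq.1.1, hz q hq.2⟩
  have hd1 : ∀ q ∈ I, ∀ q' ∈ I, q ≠ q' →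
      t * γ * dist (q.1 + intPoint q.2) (q'.1 + intPoint q'.2) ≤ dist (z q) (z q') := by
    intro q hq q' hq' hne
    obtain ⟨hq1, -, hq2⟩ := hIz q hq
    obtain ⟨hq1', -, hq2'⟩ := hIz q' hq'
    have h1 := hsep q q' hq1 hq1' hne
    have h2 : dist (P q) (P q') ≤ dist (P q) (z q) + dist (z q) (z q') + dist (z q') (P q') :=
      dist_triangle4 _ _ _ _
    rw [hPdist, dist_comm (z q') (P q')] at h2
    have h3 : 0 ≤ 1 - γ := by
      by_contra! h
      nlinarith
    have h4 : 2 * θ ≤ (1 - γ) * dist (q.1 + intPoint q.2) (q'.1 + intPoint q'.2) :=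
      hθσ.trans (by gcongr)
    nlinarith
  have hpos : ∀ q ∈ I, ∀ q' ∈ I, q ≠ q' →
      0 < dist (q.1 + intPoint q.2) (q'.1 + intPoint q'.2) := fun q hq q' hq' hne =>
    hσ.trans_le (hsep q q' (hIz q hq).1 (hIz q' hq').1 hne)
  have hinj : Set.InjOn z I := by
    intro q hq q' hq' h
    by_contra hne
    have h1 := hd1 q hq q' hq' hne
    have h2 := hpos q hq q' hq' hne
    rw [h, dist_self] at h1
    have : 0 < t * γ * dist (q.1 + intPoint q.2) (q'.1 + intPoint q'.2) := by positivity
    linarith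
  have hcard : (I.image z).card = I.card := Finset.card_image_of_injOn hinj
  have hIc : I.card + ((Y ×ˢ T).filter fun q => ¬ near q).card = Y.card * T.card := by
    rw [← Finset.card_product]
    exact Finset.card_filter_add_card_filter_not _
  have hIc' : (I.card : ℝ) + ((Y ×ˢ T).filter fun q => ¬ near q).card = Y.card * T.card := by
    exact_mod_cast hIc
  have hY0 : (0 : ℝ) ≤ Y.card := by positivity
  refine ⟨I.image z, ?_, ?_, ?_, ?_⟩
  · intro x hx
    obtain ⟨q, hq, rfl⟩ := Finset.mem_image.1 (Finset.mem_coe.1 hx)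
    exact (hIz q hq).2.1
  · rw [hcard]
    have h1 : (I.card : ℝ) ≤ Y.card * T.card := by
      rw [← hIc']; simp
    calc (I.card : ℝ) * t ^ d ≤ (Y.card * T.card) * t ^ d := by gcongr
      _ = Y.card * (T.card * t ^ d) := by ring
      _ ≤ _ := by gcongr
  · rw [hcard]
    have hKm := hK.measurableSet
    have hcth : IsCompact (cthickening ((√d + θ) * t) K) := hK.cthickening
    have h1 := card_mul_le_of_separated (I := (Y ×ˢ T).filter fun q => ¬ near q) (x := P)
      (r := θ * t) (S := cthickening ((√d + θ) * t) K \ K) (by positivity)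
      ((measure_mono sdiff_subset).trans_lt hcth.measure_lt_top).ne ?_ ?_
    · rw [measureReal_sdiff (self_subset_cthickening K) hKm hcth.measure_lt_top.ne] at h1
      have h2 : 0 < ballVolume d * θ ^ d := by have := ballVolume_pos (d := d); positivity
      have h3 : (((Y ×ˢ T).filter fun q => ¬ near q).card : ℝ) * t ^ d ≤
          (volume.real (cthickening ((√d + θ) * t) K) - volume.real K) / (ballVolume d * θ ^ d) := by
        rw [le_div_iff₀ h2]
        calc _ = _ := by ring
          _ ≤ _ := h1
      have h4 : (Y.card : ℝ) * volume.real K ≤ Y.card * (T.card * t ^ d) := by gcongr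
      have h5 : (Y.card : ℝ) * (T.card * t ^ d) = I.card * t ^ d +
          ((Y ×ˢ T).filter fun q => ¬ near q).card * t ^ d := by rw [← add_mul, hIc']; ring
      linarith
    · intro q hq q' hq' hne
      rw [Finset.mem_filter, Finset.mem_product] at hq hq'
      rw [hPdist]
      have h1 := hsep q q' hq.1.1 hq'.1.1 hne
      have h2 : 0 < γ * σ := by positivity
      calc 2 * (θ * t) = t * (2 * θ) := by ring
        _ ≤ t * σ := by gcongr; linarith
        _ ≤ _ := by gcongr
    · intro q hq w hw
      rw [Finset.mem_filter, Finset.mem_product] at hq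
      obtain ⟨⟨hq1, hq2⟩, hq3⟩ := hq
      rw [mem_ball, dist_comm] at hw
      refine ⟨?_, fun hwK => hq3 ⟨w, hwK, hw.le⟩⟩
      have h1 : q.2 ∈ cell t '' K := hTK ▸ Finset.mem_coe.2 hq2
      obtain ⟨x, hx, hxq⟩ := h1
      have h2 : dist (P q) x ≤ √d * t := dist_le_of_cell_eq ht (by
        rw [hxq]; exact cell_smul_add_intPoint ht (hY _ hq1) _)
      refine mem_cthickening_of_dist_le w x _ K hx ?_
      have h3 := dist_triangle w (P q) x
      rw [dist_comm] at hw
      linarith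
  · have h1 := energy_image (s := s) hinj
    have h2 : energy s I z ≤ (t * γ) ^ (-s) * energy s I (fun q => q.1 + intPoint q.2) :=
      energy_le_of_dist_le hs.le (by positivity)
        (fun q hq q' hq' hne => dist_pos.1 (hpos q hq q' hq' hne)) hd1
    have h3 : energy s I (fun q => q.1 + intPoint q.2) ≤ T.card * M :=
      (energy_mono (Finset.filter_subset _ _) _).trans (hE T)
    have h4 : t ^ ((d : ℝ) + s) = t ^ d * t ^ s := by
      rw [Real.rpow_add ht, Real.rpow_natCast]
    have h5 : (t * γ) ^ (-s) * t ^ s = γ ^ (-s) := by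
      rw [Real.mul_rpow ht.le hγ.le, mul_right_comm, ← Real.rpow_add ht]; simp
    rw [h1, h4]
    calc energy s I z * (t ^ d * t ^ s)
        ≤ ((t * γ) ^ (-s) * (T.card * M)) * (t ^ d * t ^ s) := by
          gcongr
          exact h2.trans (by gcongr)
      _ = ((t * γ) ^ (-s) * t ^ s) * M * (T.card * t ^ d) := by ring
      _ ≤ _ := by rw [h5]; gcongr

/-- If `c` is not a lower constant, then compact sets can be filled by configurations of
prescribed density and small energy. -/
theorem exists_filling (hd : 1 ≤ d) (hs : (d : ℝ) < s) {c c' : ℝ} (hc0 : 0 ≤ c)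
    (hc : ¬ IsLowerConst d s c) (hcc : c < c') :
    ∃ n₀ : ℝ, 0 < n₀ ∧ ∀ K : Set (EuclideanSpace ℝ (Fin d)), IsCompact K →
      ∃ (ω : ℝ → Finset (EuclideanSpace ℝ (Fin d))) (u : ℝ → ℝ), (∀ t > 0, ↑(ω t) ⊆ K) ∧
        Tendsto (fun t => ((ω t).card : ℝ) * t ^ d) (𝓝[>] 0) (𝓝 (n₀ * volume.real K)) ∧
        Tendsto u (𝓝[>] 0) (𝓝 (c' * n₀ ^ (1 + s / d) * volume.real K)) ∧
        ∀ t > 0, energy s (ω t) id * t ^ ((d : ℝ) + s) ≤ u t := by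
  have hd0 : (0 : ℝ) < d := by exact_mod_cast hd
  have hs0 : 0 < s := hd0.trans hs
  set c₁ := (c + c') / 2 with hc₁
  obtain ⟨Y, hYc, hY, hE⟩ := exists_periodic hd hs hc0 hc (c' := c₁) (by linarith)
  have hc₁0 : 0 < c₁ := by linarith
  set M := c₁ * (Y.card : ℝ) ^ (1 + s / d) with hM
  have hM0 : 0 ≤ M := by positivity
  obtain ⟨σ, hσ, hsep⟩ := exists_separation hs0 hY hM0 hE
  obtain ⟨γ, hγc, hγ1, hγ0⟩ : ∃ γ : ℝ, γ ^ (-s) * c₁ < c' ∧ γ < 1 ∧ 0 < γ := by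
    have h1 : Tendsto (fun γ : ℝ => γ ^ (-s) * c₁) (𝓝[<] 1) (𝓝 ((1 : ℝ) ^ (-s) * c₁)) :=
      (((Real.continuousAt_rpow_const 1 (-s) (Or.inl one_ne_zero)).tendsto).mul_const c₁).mono_left
        nhdsWithin_le_nhds
    rw [Real.one_rpow, one_mul] at h1
    have h2 := h1.eventually_lt_const (by linarith : c₁ < c')
    have h3 : ∀ᶠ γ : ℝ in 𝓝[<] 1, 0 < γ :=
      (lt_mem_nhds one_pos).filter_mono nhdsWithin_le_nhds
    have h4 : ∀ᶠ γ : ℝ in 𝓝[<] 1, γ < 1 := self_mem_nhdsWithin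
    obtain ⟨γ, h⟩ := (h2.and (h4.and h3)).exists
    exact ⟨γ, h⟩
  set θ := (1 - γ) * σ / 2 with hθ
  have hθ0 : 0 < θ := by
    have : 0 < 1 - γ := by linarith
    positivity
  refine ⟨Y.card, by exact_mod_cast hYc, fun K hK => ?_⟩
  have hfix : ∀ t : ℝ, ∃ ω : Finset (EuclideanSpace ℝ (Fin d)), 0 < t → ↑ω ⊆ K ∧
      (ω.card : ℝ) * t ^ d ≤ Y.card * volume.real (cthickening (√d * t) K) ∧
      (Y.card : ℝ) * volume.real K -
        (volume.real (cthickening ((√d + θ) * t) K) - volume.real K) / (ballVolume d * θ ^ d) ≤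
          ω.card * t ^ d ∧
      energy s ω id * t ^ ((d : ℝ) + s) ≤ γ ^ (-s) * M * volume.real (cthickening (√d * t) K) := by
    intro t
    by_cases ht : 0 < t
    · obtain ⟨ω, hω⟩ := exists_subset_of_periodic hs0 hY hM0 hE hσ hsep hγ0 hθ0
        (by rw [hθ]; linarith) hK ht
      exact ⟨ω, fun _ => hω⟩
    · exact ⟨∅, fun h => (ht h).elim⟩
  choose ω hω using hfix
  have hV1 := tendsto_volume_cthickening hK (√d)
  have hV2 := tendsto_volume_cthickening hK (√d + θ)
  refine ⟨ω, fun t => c' * (Y.card : ℝ) ^ (1 + s / d) * volume.real (cthickening (√d * t) K),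
    fun t ht => (hω t ht).1, ?_, hV1.const_mul _, fun t ht => ?_⟩
  · have hlow : Tendsto (fun t : ℝ => (Y.card : ℝ) * volume.real K -
        (volume.real (cthickening ((√d + θ) * t) K) - volume.real K) / (ballVolume d * θ ^ d))
        (𝓝[>] 0) (𝓝 (Y.card * volume.real K)) := by
      have := ((hV2.sub_const (volume.real K)).div_const (ballVolume d * θ ^ d)).const_sub
        ((Y.card : ℝ) * volume.real K)
      simpa using this
    refine tendsto_of_tendsto_of_tendsto_of_le_of_le' hlow (hV1.const_mul _) ?_ ?_
    · filter_upwards [self_mem_nhdsWithin] with t ht using (hω t ht).2.2.1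
    · filter_upwards [self_mem_nhdsWithin] with t ht using (hω t ht).2.1
  · refine (hω t ht).2.2.2.trans ?_
    rw [hM, ← mul_assoc]
    beta_reduce
    gcongr

end Filling

section Hausdorff

variable {d d' : ℕ}

theorem hausdorffMeasure_eq_smul :
    (μH[(d : ℝ)] : Measure (EuclideanSpace ℝ (Fin d))) = μH[(d : ℝ)] (unitCube d) • volume := by
  set κ := (μH[(d : ℝ)] : Measure (EuclideanSpace ℝ (Fin d))).addHaarScalarFactor volume
  have h : (μH[(d : ℝ)] : Measure (EuclideanSpace ℝ (Fin d))) = κ • volume :=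
    Measure.isAddLeftInvariant_eq_smul _ _
  have h2 : μH[(d : ℝ)] (unitCube d) = κ := by
    rw [h, Measure.smul_apply, volume_unitCube, ENNReal.smul_def, smul_eq_mul, mul_one]
  rw [h2]
  exact h

theorem hausdorffMeasure_unitCube_ne_zero : μH[(d : ℝ)] (unitCube d) ≠ 0 := by
  intro h
  have h1 := hausdorffMeasure_eq_smul (d := d)
  rw [h, zero_smul] at h1
  exact (NeZero.ne (μH[(d : ℝ)] : Measure (EuclideanSpace ℝ (Fin d)))) h1

theorem hausdorffMeasure_unitCube_ne_top : μH[(d : ℝ)] (unitCube d) ≠ ∞ :=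
  isCompact_unitCube.measure_lt_top.ne

theorem normHausdorff_image_le {f : EuclideanSpace ℝ (Fin d) → EuclideanSpace ℝ (Fin d')}
    {S : Set (EuclideanSpace ℝ (Fin d))} {C : ℝ≥0} (hf : LipschitzOnWith C f S) :
    normHausdorff d d' (f '' S) ≤ (C : ℝ≥0∞) ^ d * volume S := by
  have h1 := hf.hausdorffMeasure_image_le (d := d) (by positivity)
  rw [normHausdorff, Measure.smul_apply, smul_eq_mul]
  rw [ENNReal.rpow_natCast, hausdorffMeasure_eq_smul, Measure.smul_apply, smul_eq_mul] at h1
  calc _ ≤ (μH[(d : ℝ)] (unitCube d))⁻¹ * (C ^ d * (μH[(d : ℝ)] (unitCube d) * volume S)) := by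
        gcongr
    _ = (μH[(d : ℝ)] (unitCube d))⁻¹ * (μH[(d : ℝ)] (unitCube d)) * (C ^ d * volume S) := by ring
    _ = _ := by
      rw [ENNReal.inv_mul_cancel hausdorffMeasure_unitCube_ne_zero hausdorffMeasure_unitCube_ne_top,
        one_mul]

theorem volume_image_le {g : EuclideanSpace ℝ (Fin d') → EuclideanSpace ℝ (Fin d)}
    {B : Set (EuclideanSpace ℝ (Fin d'))} {C : ℝ≥0} (hg : LipschitzOnWith C g B) :
    volume (g '' B) ≤ (C : ℝ≥0∞) ^ d * normHausdorff d d' B := by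
  have h1 := hg.hausdorffMeasure_image_le (d := d) (by positivity)
  rw [normHausdorff, Measure.smul_apply, smul_eq_mul]
  rw [ENNReal.rpow_natCast, hausdorffMeasure_eq_smul, Measure.smul_apply, smul_eq_mul] at h1
  calc volume (g '' B)
      = (μH[(d : ℝ)] (unitCube d))⁻¹ * (μH[(d : ℝ)] (unitCube d) * volume (g '' B)) := by
        rw [← mul_assoc, ENNReal.inv_mul_cancel hausdorffMeasure_unitCube_ne_zero
          hausdorffMeasure_unitCube_ne_top, one_mul]
    _ ≤ (μH[(d : ℝ)] (unitCube d))⁻¹ * (C ^ d * μH[(d : ℝ)] B) := by gcongr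
    _ = _ := by ring

theorem real_normHausdorff_image_le {f : EuclideanSpace ℝ (Fin d) → EuclideanSpace ℝ (Fin d')}
    {S : Set (EuclideanSpace ℝ (Fin d))} (hS : volume S ≠ ∞) {c : ℝ} (hc : 0 ≤ c)
    (hf : ∀ x ∈ S, ∀ y ∈ S, dist (f x) (f y) ≤ c * dist x y) :
    (normHausdorff d d').real (f '' S) ≤ c ^ d * volume.real S := by
  lift c to ℝ≥0 using hc
  have := ENNReal.toReal_mono (ENNReal.mul_ne_top (by simp) hS)
    (normHausdorff_image_le (LipschitzOnWith.of_dist_le_mul hf))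
  simpa [Measure.real, ENNReal.toReal_mul] using this

theorem volume_real_image_le {g : EuclideanSpace ℝ (Fin d') → EuclideanSpace ℝ (Fin d)}
    {B : Set (EuclideanSpace ℝ (Fin d'))} (hB : normHausdorff d d' B ≠ ∞) {c : ℝ} (hc : 0 ≤ c)
    (hg : ∀ x ∈ B, ∀ y ∈ B, dist (g x) (g y) ≤ c * dist x y) :
    volume.real (g '' B) ≤ c ^ d * (normHausdorff d d').real B := by
  lift c to ℝ≥0 using hc
  have := ENNReal.toReal_mono (ENNReal.mul_ne_top (by simp) hB)
    (volume_image_le (LipschitzOnWith.of_dist_le_mul hg))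
  simpa [Measure.real, ENNReal.toReal_mul] using this

end Hausdorff

section Decomposition

/-- A finite measure carried by a countable union of measurable sets is almost carried by a finite
disjoint union of compact subsets of these sets. -/
theorem exists_disjoint_isCompact {X : Type*} [TopologicalSpace X] [T2Space X] [MeasurableSpace X]
    [OpensMeasurableSpace X] {μ : Measure X} [IsFiniteMeasure μ] [μ.InnerRegularCompactLTTop]
    {C : ℕ → Set X} (hC : ∀ i, MeasurableSet (C i)) (h0 : μ (⋃ i, C i)ᶜ = 0) {δ : ℝ≥0∞}
    (hδ : 0 < δ) :
    ∃ (n : ℕ) (B : ℕ → Set X), (∀ i, IsCompact (B i)) ∧ (∀ i, B i ⊆ C i) ∧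
      Pairwise (Function.onFun Disjoint B) ∧ μ (⋃ i ∈ Finset.range n, B i)ᶜ < δ := by
  have hD := MeasurableSet.disjointed hC
  set D := disjointed C with hDdef
  obtain ⟨δ', hδ'0, hδ'⟩ := ENNReal.exists_pos_sum_of_countable (ENNReal.half_pos hδ.ne').ne' ℕ
  have hB : ∀ i, ∃ K ⊆ D i, IsCompact K ∧ μ (D i \ K) < δ' i := fun i =>
    (hD i).exists_isCompact_sdiff_lt (measure_ne_top _ _) (by exact_mod_cast (hδ'0 i).ne')
  choose B hBD hBc hBμ using hB
  have hlim : Tendsto (fun n => μ (⋃ i ∈ Finset.range n, D i)ᶜ) atTop (𝓝 0) := by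
    have h1 : Antitone fun n : ℕ => (⋃ i ∈ Finset.range n, D i)ᶜ := by
      intro m n hmn
      refine compl_subset_compl.2 (biUnion_subset_biUnion_left ?_)
      intro i hi
      simp only [Finset.coe_range, Set.mem_Iio] at hi ⊢
      exact hi.trans_le hmn
    have h2 := tendsto_measure_iInter_atTop (μ := μ)
      (fun n => ((Finset.measurableSet_biUnion (Finset.range n) fun i _ =>
        hD i).compl).nullMeasurableSet) h1 ⟨0, measure_ne_top _ _⟩
    have h3 : (⋂ n : ℕ, (⋃ i ∈ Finset.range n, D i)ᶜ) = (⋃ i, C i)ᶜ := by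
      rw [← compl_iUnion, ← iUnion_disjointed (f := C)]
      congr 1
      ext x
      simp only [mem_iUnion, Finset.mem_range]
      exact ⟨fun ⟨_, i, _, h⟩ => ⟨i, h⟩, fun ⟨i, h⟩ => ⟨i + 1, i, Nat.lt_succ_self i, h⟩⟩
    rw [h3, h0] at h2
    exact h2
  obtain ⟨n, hn⟩ := (hlim.eventually_lt_const (ENNReal.half_pos hδ.ne')).exists
  refine ⟨n, B, hBc, fun i => (hBD i).trans (disjointed_subset C i),
    fun i j hij => (disjoint_disjointed C hij).mono (hBD i) (hBD j), ?_⟩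
  have hsub : (⋃ i ∈ Finset.range n, B i)ᶜ ⊆
      (⋃ i ∈ Finset.range n, D i)ᶜ ∪ ⋃ i ∈ Finset.range n, (D i \ B i) := by
    intro x hx
    by_cases h : x ∈ ⋃ i ∈ Finset.range n, D i
    · right
      simp only [mem_iUnion, mem_compl_iff, not_exists] at h hx ⊢
      obtain ⟨i, hi, hxi⟩ := h
      exact ⟨i, hi, hxi, hx i hi⟩
    · exact Or.inl h
  calc _ ≤ μ (⋃ i ∈ Finset.range n, D i)ᶜ + μ (⋃ i ∈ Finset.range n, (D i \ B i)) :=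
        (measure_mono hsub).trans (measure_union_le _ _)
    _ ≤ μ (⋃ i ∈ Finset.range n, D i)ᶜ + ∑ i ∈ Finset.range n, μ (D i \ B i) := by
        gcongr; exact measure_biUnion_finset_le _ _
    _ ≤ μ (⋃ i ∈ Finset.range n, D i)ᶜ + ∑' i, (δ' i : ℝ≥0∞) := by
        gcongr
        exact (Finset.sum_le_sum fun i _ => (hBμ i).le).trans (ENNReal.sum_le_tsum _)
    _ < δ / 2 + δ / 2 := ENNReal.add_lt_add hn hδ'
    _ = δ := ENNReal.add_halves δ

end Decomposition

section Flat

variable {d d' : ℕ}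

/-- A map into `ℝ^d` distorting distances in `B` at most by the factor `1 + ε`. -/
def IsAlmostIsometryOn {X : Type*} [MetricSpace X] (ε : ℝ) (g : X → EuclideanSpace ℝ (Fin d))
    (B : Set X) : Prop :=
  ∀ x ∈ B, ∀ y ∈ B, dist x y ≤ (1 + ε) * dist (g x) (g y) ∧ dist (g x) (g y) ≤ (1 + ε) * dist x y

theorem IsAlmostIsometryOn.mono {X : Type*} [MetricSpace X] {ε : ℝ}
    {g : X → EuclideanSpace ℝ (Fin d)} {B C : Set X} (h : IsAlmostIsometryOn ε g C) (hBC : B ⊆ C) :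
    IsAlmostIsometryOn ε g B := fun x hx y hy => h x (hBC hx) y (hBC hy)

theorem exists_isAlmostIsometryOn_image
    {φ : EuclideanSpace ℝ (Fin d) → EuclideanSpace ℝ (Fin d')}
    {T : EuclideanSpace ℝ (Fin d) →L[ℝ] EuclideanSpace ℝ (Fin d')}
    {S : Set (EuclideanSpace ℝ (Fin d))} {L η : ℝ} (hη : 0 ≤ η)
    (hT : ∀ v, ‖v‖ ≤ L * ‖T v‖) (hφ : ∀ x ∈ S, ∀ y ∈ S, dist x y ≤ L * dist (φ x) (φ y))
    (happ : ∀ x ∈ S, ∀ y ∈ S, ‖φ x - φ y - T (x - y)‖ ≤ η * ‖x - y‖) :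
    ∃ g : EuclideanSpace ℝ (Fin d') → EuclideanSpace ℝ (Fin d),
      IsAlmostIsometryOn (η * L) g (φ '' S) := by
  have hTinj : Function.Injective T.toLinearMap := by
    rw [← LinearMap.ker_eq_bot, LinearMap.ker_eq_bot']
    intro v hv
    have h1 := hT v
    have h2 : T v = 0 := hv
    rw [h2, norm_zero, mul_zero] at h1
    exact norm_le_zero_iff.1 h1
  have hrank : Module.finrank ℝ (LinearMap.range T.toLinearMap) = d := by
    rw [LinearMap.finrank_range_of_inj hTinj, finrank_euclideanSpace_fin]
  set e : LinearMap.range T.toLinearMap ≃ₗᵢ[ℝ] EuclideanSpace ℝ (Fin d) :=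
    ((stdOrthonormalBasis ℝ (LinearMap.range T.toLinearMap)).reindex (finCongr hrank)).repr
  set ψ := Function.invFunOn φ S
  set g : EuclideanSpace ℝ (Fin d') → EuclideanSpace ℝ (Fin d) :=
    fun z => e (T.toLinearMap.rangeRestrict (ψ z)) with hg
  have hφinj : Set.InjOn φ S := by
    intro x hx y hy h
    have := hφ x hx y hy
    rw [h, dist_self, mul_zero] at this
    exact dist_le_zero.1 this
  have hgφ : ∀ x ∈ S, ∀ y ∈ S, dist (g (φ x)) (g (φ y)) = ‖T (x - y)‖ := by
    intro x hx y hy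
    have h1 : ψ (φ x) = x := hφinj.leftInvOn_invFunOn hx
    have h2 : ψ (φ y) = y := hφinj.leftInvOn_invFunOn hy
    simp only [hg, h1, h2]
    rw [e.dist_map, Subtype.dist_eq, dist_eq_norm, map_sub]
    rfl
  refine ⟨g, ?_⟩
  rintro _ ⟨x, hx, rfl⟩ _ ⟨y, hy, rfl⟩
  rw [hgφ x hx y hy, dist_eq_norm]
  have h1 := happ x hx y hy
  have h2 := hφ x hx y hy
  rw [dist_eq_norm, dist_eq_norm] at h2
  have h3 := hT (x - y)
  have h4 := norm_sub_norm_le (φ x - φ y) (T (x - y))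
  have h5 := norm_sub_norm_le (T (x - y)) (φ x - φ y)
  rw [norm_sub_rev (T (x - y))] at h5
  have h6 := mul_le_mul_of_nonneg_left h2 hη
  have h7 := mul_le_mul_of_nonneg_left h3 hη
  constructor <;> nlinarith

theorem norm_le_mul_norm_fderiv {φ : EuclideanSpace ℝ (Fin d) → EuclideanSpace ℝ (Fin d')}
    {T : EuclideanSpace ℝ (Fin d) →L[ℝ] EuclideanSpace ℝ (Fin d')}
    {G : Set (EuclideanSpace ℝ (Fin d))} (hG : IsOpen G) {L : ℝ}
    (hφ : ∀ x ∈ G, ∀ y ∈ G, dist x y ≤ L * dist (φ x) (φ y)) {x : EuclideanSpace ℝ (Fin d)}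
    (hx : x ∈ G) (hT : HasFDerivAt φ T x) (v : EuclideanSpace ℝ (Fin d)) :
    ‖v‖ ≤ L * ‖T v‖ := by
  have h1 := (hT.hasLineDerivAt v).tendsto_slope_zero_right.norm.const_mul L
  have h2 : ∀ᶠ t : ℝ in 𝓝[>] 0, x + t • v ∈ G := by
    have h3 : Tendsto (fun t : ℝ => x + t • v) (𝓝[>] 0) (𝓝 (x + (0 : ℝ) • v)) :=
      (Continuous.tendsto (by fun_prop) 0).mono_left nhdsWithin_le_nhds
    rw [zero_smul, add_zero] at h3
    exact h3.eventually (hG.mem_nhds hx)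
  refine ge_of_tendsto h1 ?_
  filter_upwards [h2, self_mem_nhdsWithin] with t ht ht0
  have ht0 : 0 < t := ht0
  have h3 := hφ _ ht _ hx
  rw [dist_eq_norm, dist_eq_norm, add_sub_cancel_left, norm_smul, Real.norm_of_nonneg ht0.le] at h3
  rw [norm_smul, norm_inv, Real.norm_of_nonneg ht0.le]
  calc ‖v‖ = t⁻¹ * (t * ‖v‖) := by field_simp
    _ ≤ t⁻¹ * (L * ‖φ (x + t • v) - φ x‖) := by gcongr
    _ = _ := by ring

theorem exists_almostIsometric_cover {φ : EuclideanSpace ℝ (Fin d) → EuclideanSpace ℝ (Fin d')}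
    {G K : Set (EuclideanSpace ℝ (Fin d))} (hK : IsCompact K) (hG : IsOpen G) (hKG : K ⊆ G) {L : ℝ}
    (hL : 1 ≤ L) (hφ : ∀ x ∈ G, ∀ y ∈ G,
      (1 / L) * dist x y ≤ dist (φ x) (φ y) ∧ dist (φ x) (φ y) ≤ L * dist x y) {ε : ℝ}
    (hε : 0 < ε) :
    ∃ C : ℕ → Set (EuclideanSpace ℝ (Fin d')), (∀ n, MeasurableSet (C n)) ∧
      (∀ n, C n ⊆ φ '' K) ∧
      (∀ n, ∃ g : EuclideanSpace ℝ (Fin d') → EuclideanSpace ℝ (Fin d),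
        IsAlmostIsometryOn ε g (C n)) ∧
      normHausdorff d d' (φ '' K \ ⋃ n, C n) = 0 := by
  have hL0 : 0 < L := by linarith
  have hφ1 : ∀ x ∈ G, ∀ y ∈ G, dist x y ≤ L * dist (φ x) (φ y) := fun x hx y hy => by
    have h := (hφ x hx y hy).1
    rwa [one_div, inv_mul_le_iff₀ hL0] at h
  have hlip : LipschitzOnWith ⟨L, hL0.le⟩ φ G :=
    LipschitzOnWith.of_dist_le_mul fun x hx y hy => (hφ x hx y hy).2
  have hinj : Set.InjOn φ G := by
    intro x hx y hy h
    have := hφ1 x hx y hy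
    rw [h, dist_self, mul_zero] at this
    exact dist_le_zero.1 this
  set K₀ := K ∩ {x | DifferentiableAt ℝ φ x} with hK₀
  have hK₀m : MeasurableSet K₀ := hK.measurableSet.inter (measurableSet_of_differentiableAt ℝ φ)
  have hnull : volume (K \ K₀) = 0 := by
    have h1 := hlip.ae_differentiableWithinAt (μ := volume) hG.measurableSet
    rw [ae_restrict_iff' hG.measurableSet] at h1
    refine measure_mono_null ?_ (ae_iff.1 h1)
    rintro x ⟨hxK, hx⟩ h
    exact hx ⟨hxK, (h (hKG hxK)).differentiableAt (hG.mem_nhds (hKG hxK))⟩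
  have hη : 0 < ε / L := by positivity
  obtain ⟨t, T, -, htm, hcov, happ, hT⟩ := exists_partition_approximatesLinearOn_of_hasFDerivWithinAt
    φ K₀ (fderiv ℝ φ) (fun x hx => hx.2.hasFDerivAt.hasFDerivWithinAt) (fun _ => ⟨ε / L, hη.le⟩)
    (fun _ => by
      intro h
      exact hη.ne' (congrArg NNReal.toReal h))
  have hsub : ∀ n, K₀ ∩ t n ⊆ G := fun n x hx => hKG hx.1.1
  refine ⟨fun n => φ '' (K₀ ∩ t n), fun n => ?_, fun n => image_mono fun x hx => hx.1.1,
    fun n => ?_, ?_⟩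
  · exact (hK₀m.inter (htm n)).image_of_continuousOn_injOn (hlip.continuousOn.mono (hsub n))
      (hinj.mono (hsub n))
  · rcases K₀.eq_empty_or_nonempty with h | h
    · exact ⟨fun _ => 0, by rintro _ ⟨x, hx, rfl⟩; simp [h] at hx⟩
    · obtain ⟨y, hy, hTy⟩ := hT h n
      have h1 := exists_isAlmostIsometryOn_image (S := K₀ ∩ t n) hη.le
        (norm_le_mul_norm_fderiv hG hφ1 (hKG hy.1) (hTy ▸ hy.2.hasFDerivAt))
        (fun x hx y hy => hφ1 x (hsub n hx) y (hsub n hy))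
        (fun x hx y hy => happ n x hx y hy)
      rwa [div_mul_cancel₀ _ hL0.ne'] at h1
  · have h1 : φ '' K \ ⋃ n, φ '' (K₀ ∩ t n) ⊆ φ '' (K \ K₀) := by
      rintro _ ⟨⟨x, hx, rfl⟩, hx2⟩
      refine ⟨x, ⟨hx, fun hx0 => hx2 ?_⟩, rfl⟩
      obtain ⟨n, hn⟩ := mem_iUnion.1 (hcov hx0)
      exact mem_iUnion.2 ⟨n, x, ⟨hx0, hn⟩, rfl⟩
    refine measure_mono_null h1 (le_antisymm ?_ bot_le)
    have h2 := normHausdorff_image_le (hlip.mono (sdiff_subset.trans hKG : K \ K₀ ⊆ G))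
    rwa [hnull, mul_zero] at h2

end Flat

section Rectifiable

variable {d d' : ℕ} {A : Set (EuclideanSpace ℝ (Fin d'))}

theorem isCompact_of_isRectifiableManifold (hA : IsRectifiableManifold d d' A) : IsCompact A := by
  obtain ⟨n, K, φ, hK, hφ, rfl⟩ := hA
  refine isCompact_iUnion fun k => ?_
  obtain ⟨G, L, -, hKG, hL, h⟩ := hφ k
  have hlip : LipschitzOnWith ⟨L, by linarith⟩ (φ k) G :=
    LipschitzOnWith.of_dist_le_mul fun x hx y hy => (h x hx y hy).2
  exact (hK k).image_of_continuousOn (hlip.continuousOn.mono hKG)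

theorem normHausdorff_lt_top (hA : IsRectifiableManifold d d' A) : normHausdorff d d' A < ∞ := by
  obtain ⟨n, K, φ, hK, hφ, rfl⟩ := hA
  refine (measure_iUnion_fintype_le _ _).trans_lt (ENNReal.sum_lt_top.2 fun k _ => ?_)
  obtain ⟨G, L, -, hKG, hL, h⟩ := hφ k
  have hlip : LipschitzOnWith ⟨L, by linarith⟩ (φ k) G :=
    LipschitzOnWith.of_dist_le_mul fun x hx y hy => (h x hx y hy).2
  refine (normHausdorff_image_le (hlip.mono hKG)).trans_lt ?_
  exact ENNReal.mul_lt_top (ENNReal.pow_lt_top ENNReal.coe_lt_top) (hK k).measure_lt_top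

/-- A rectifiable manifold is, up to a set of small measure, a finite disjoint union of small
compact sets that are almost isometric to subsets of `ℝ^d`. -/
theorem exists_decomposition (hA : IsRectifiableManifold d d' A) (hA0 : A.Nonempty) {ε r : ℝ}
    (hε : 0 < ε) (hr : 0 < r) {δ : ℝ} (hδ : 0 < δ) :
    ∃ (n : ℕ) (B : ℕ → Set (EuclideanSpace ℝ (Fin d')))
      (g : ℕ → EuclideanSpace ℝ (Fin d') → EuclideanSpace ℝ (Fin d)),
      (∀ i, IsCompact (B i)) ∧ (∀ i, B i ⊆ A) ∧ Pairwise (Function.onFun Disjoint B) ∧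
      (∀ i, ∀ x ∈ B i, ∀ y ∈ B i, dist x y ≤ r) ∧ (∀ i, IsAlmostIsometryOn ε (g i) (B i)) ∧
      (normHausdorff d d').real (A \ ⋃ i ∈ Finset.range n, B i) < δ := by
  have hAc := isCompact_of_isRectifiableManifold hA
  have hfin := normHausdorff_lt_top hA
  obtain ⟨n, K, φ, hK, hφ, hAK⟩ := hA
  have hcov : ∀ k, ∃ C : ℕ → Set (EuclideanSpace ℝ (Fin d')), (∀ n, MeasurableSet (C n)) ∧
      (∀ n, C n ⊆ φ k '' K k) ∧
      (∀ n, ∃ g : EuclideanSpace ℝ (Fin d') → EuclideanSpace ℝ (Fin d),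
        IsAlmostIsometryOn ε g (C n)) ∧
      normHausdorff d d' (φ k '' K k \ ⋃ n, C n) = 0 := by
    intro k
    obtain ⟨G, L, hG, hKG, hL, h⟩ := hφ k
    exact exists_almostIsometric_cover (hK k) hG hKG hL h hε
  choose C hCm hCK hCg hC0 using hcov
  choose g hg using hCg
  set t := r / (√d' + 1) with ht
  have ht0 : 0 < t := by positivity
  have htr : √d' * t ≤ r := by
    rw [ht, mul_div_assoc', div_le_iff₀ (by positivity)]
    nlinarith
  have : Nonempty (Fin n) := by
    obtain ⟨x, hx⟩ := hA0
    rw [hAK] at hx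
    exact ⟨(mem_iUnion.1 hx).choose⟩
  obtain ⟨e, he⟩ := exists_surjective_nat (Fin n × ℕ × (Fin d' → ℤ))
  set D : ℕ → Set (EuclideanSpace ℝ (Fin d')) := fun i =>
    C (e i).1 (e i).2.1 ∩ cell t ⁻¹' {(e i).2.2} with hD
  have hDA : ∀ i, D i ⊆ A := fun i x hx => by
    rw [hAK]
    exact mem_iUnion.2 ⟨(e i).1, hCK _ _ hx.1⟩
  have hDU : ⋃ i, D i = ⋃ k, ⋃ n, C k n := by
    ext x
    simp only [hD, mem_iUnion]
    constructor
    · rintro ⟨i, hi⟩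
      exact ⟨_, _, hi.1⟩
    · rintro ⟨k, m, h⟩
      obtain ⟨i, hi⟩ := he (k, m, cell t x)
      exact ⟨i, by rw [hi]; exact ⟨h, rfl⟩⟩
  set μ := (normHausdorff d d').restrict A with hμ
  have : IsFiniteMeasure μ := ⟨by rwa [hμ, Measure.restrict_apply_univ]⟩
  have hμ0 : μ (⋃ i, D i)ᶜ = 0 := by
    rw [hμ, Measure.restrict_apply' hAc.measurableSet, hDU]
    have h1 : (⋃ k, ⋃ n, C k n)ᶜ ∩ A ⊆ ⋃ k, (φ k '' K k \ ⋃ n, C k n) := by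
      rintro x ⟨hx1, hx2⟩
      rw [hAK] at hx2
      obtain ⟨k, hk⟩ := mem_iUnion.1 hx2
      exact mem_iUnion.2 ⟨k, hk, fun h => hx1 (mem_iUnion.2 ⟨k, h⟩)⟩
    exact measure_mono_null h1 (measure_iUnion_null hC0)
  obtain ⟨m, B, hBc, hBD, hBdisj, hBμ⟩ := exists_disjoint_isCompact
    (fun i => (hCm _ _).inter (measurableSet_cell ht0 _)) hμ0 (ENNReal.ofReal_pos.2 hδ)
  refine ⟨m, B, fun i => g (e i).1 (e i).2.1, hBc, fun i => (hBD i).trans (hDA i), hBdisj,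
    fun i x hx y hy => ?_, fun i => (hg _ _).mono ((hBD i).trans inter_subset_left), ?_⟩
  · refine (dist_le_of_cell_eq ht0 ?_).trans htr
    rw [(hBD i hx).2, (hBD i hy).2]
  · rw [hμ, Measure.restrict_apply' hAc.measurableSet, inter_comm, ← sdiff_eq] at hBμ
    rw [Measure.real]
    exact (ENNReal.lt_ofReal_iff_toReal_lt (hBμ.trans ENNReal.ofReal_lt_top).ne).1 hBμ

end Rectifiable

section Move

variable {d d' : ℕ} {s : ℝ}

/-- Few separated points of a bi-Lipschitz image can be far from a subset of almost full
measure. -/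
theorem exists_card_far_le {φ : EuclideanSpace ℝ (Fin d) → EuclideanSpace ℝ (Fin d')}
    {G K : Set (EuclideanSpace ℝ (Fin d))} (hK : IsCompact K) (hKG : K ⊆ G) {L : ℝ}
    (hL : 1 ≤ L) (hφ : ∀ x ∈ G, ∀ y ∈ G,
      (1 / L) * dist x y ≤ dist (φ x) (φ y) ∧ dist (φ x) (φ y) ≤ L * dist x y)
    (hfin : normHausdorff d d' (φ '' K) ≠ ∞) {κ η τ : ℝ} (hη : 0 < η) (hηκ : 2 * η ≤ κ)
    (hτ : 0 < τ) :
    ∃ δ : ℝ, 0 < δ ∧ ∀ A' : Set (EuclideanSpace ℝ (Fin d')), IsClosed A' →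
      (normHausdorff d d').real (φ '' K \ A') ≤ δ → ∀ᶠ q : ℝ in 𝓝[>] 0,
      ∀ ω : Finset (EuclideanSpace ℝ (Fin d')), ↑ω ⊆ φ '' K →
        (∀ x ∈ ω, ∀ y ∈ ω, x ≠ y → κ * q ≤ dist x y) →
        (∀ x ∈ ω, ∀ z ∈ A', η * q < dist x z) → (ω.card : ℝ) * q ^ d ≤ τ := by
  have hL0 : 0 < L := by linarith
  have hφ1 : ∀ x ∈ G, ∀ y ∈ G, dist x y ≤ L * dist (φ x) (φ y) := fun x hx y hy => by
    have h := (hφ x hx y hy).1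
    rwa [one_div, inv_mul_le_iff₀ hL0] at h
  have hlip : LipschitzOnWith ⟨L, hL0.le⟩ φ G :=
    LipschitzOnWith.of_dist_le_mul fun x hx y hy => (hφ x hx y hy).2
  have hinj : Set.InjOn φ G := by
    intro x hx y hy h
    have := hφ1 x hx y hy
    rw [h, dist_self, mul_zero] at this
    exact dist_le_zero.1 this
  have hv := ballVolume_pos (d := d)
  set m := ballVolume d * (η / L) ^ d * τ with hm
  have hm0 : 0 < m := by positivity
  refine ⟨m / 2 / L ^ d, by positivity, fun A' hA' hδ => ?_⟩
  set K' := K ∩ φ ⁻¹' A' with hK'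
  have hK'c : IsCompact K' :=
    hK.of_isClosed_subset ((hlip.continuousOn.mono hKG).preimage_isClosed_of_isClosed
      hK.isClosed hA') inter_subset_left
  have hdiff : volume.real (K \ K') ≤ m / 2 := by
    set ψ := Function.invFunOn φ K with hψ
    have hψφ : ∀ x ∈ K, ψ (φ x) = x := fun x hx => (hinj.mono hKG).leftInvOn_invFunOn hx
    have h1 : K \ K' = ψ '' (φ '' (K \ K')) := by
      ext x
      constructor
      · exact fun hx => ⟨φ x, ⟨x, hx, rfl⟩, hψφ x hx.1⟩
      · rintro ⟨_, ⟨y, hy, rfl⟩, rfl⟩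
        rwa [hψφ y hy.1]
    have h2 : φ '' (K \ K') ⊆ φ '' K \ A' := by
      rintro _ ⟨x, hx, rfl⟩
      exact ⟨⟨x, hx.1, rfl⟩, fun h => hx.2 ⟨hx.1, h⟩⟩
    have h3 : normHausdorff d d' (φ '' K \ A') ≠ ∞ :=
      ((measure_mono sdiff_subset).trans_lt hfin.lt_top).ne
    have h4 := volume_real_image_le (B := φ '' (K \ K')) (g := ψ)
      ((measure_mono h2).trans_lt h3.lt_top).ne hL0.le (by
        rintro _ ⟨x, hx, rfl⟩ _ ⟨y, hy, rfl⟩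
        rw [hψφ x hx.1, hψφ y hy.1]
        exact hφ1 x (hKG hx.1) y (hKG hy.1))
    rw [← h1] at h4
    have h5 := measureReal_mono h2 h3
    calc _ ≤ _ := h4
      _ ≤ L ^ d * (m / 2 / L ^ d) := by gcongr; exact h5.trans hδ
      _ = m / 2 := by field_simp
  have hlim := (tendsto_volume_cthickening hK (η / L)).eventually_le_const
    (by linarith : volume.real K < volume.real K + m / 2)
  filter_upwards [hlim, self_mem_nhdsWithin] with q hq hq0 ω hω hsep hfar
  have hq0 : 0 < q := hq0
  set ψ := Function.invFunOn φ K with hψ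
  have hψK : ∀ x ∈ ω, ψ x ∈ K ∧ φ (ψ x) = x := fun x hx =>
    ⟨Function.invFunOn_mem (hω hx), Function.invFunOn_eq (hω hx)⟩
  have hcth : IsCompact (cthickening (η / L * q) K) := hK.cthickening
  have h1 := card_mul_le_of_separated (I := ω) (x := ψ) (r := η / L * q)
    (S := cthickening (η / L * q) K \ K') (by positivity)
    ((measure_mono sdiff_subset).trans_lt hcth.measure_lt_top).ne ?_ ?_
  · have hK'K : K' ⊆ K := inter_subset_left
    rw [measureReal_sdiff (hK'K.trans (self_subset_cthickening K)) hK'c.measurableSet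
      hcth.measure_lt_top.ne] at h1
    rw [measureReal_sdiff hK'K hK'c.measurableSet hK.measure_lt_top.ne] at hdiff
    have h2 : (ω.card : ℝ) * (ballVolume d * (η / L * q) ^ d) ≤ m := by linarith
    have h3 : 0 < ballVolume d * (η / L) ^ d := by positivity
    refine le_of_mul_le_mul_left ?_ h3
    calc _ = (ω.card : ℝ) * (ballVolume d * (η / L * q) ^ d) := by ring
      _ ≤ _ := h2
  · intro x hx y hy hne
    obtain ⟨hx1, hx2⟩ := hψK x hx
    obtain ⟨hy1, hy2⟩ := hψK y hy
    have h2 := (hφ _ (hKG hx1) _ (hKG hy1)).2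
    rw [hx2, hy2] at h2
    have h3 := (hsep x hx y hy hne).trans h2
    rw [show 2 * (η / L * q) = 2 * η * q / L by ring, div_le_iff₀ hL0]
    nlinarith
  · intro x hx w hw
    obtain ⟨hx1, hx2⟩ := hψK x hx
    rw [mem_ball] at hw
    refine ⟨mem_cthickening_of_dist_le w _ _ K hx1 hw.le, fun hwK => ?_⟩
    have h2 := hfar x hx (φ w) hwK.2
    have h3 := (hφ _ (hKG hx1) _ (hKG hwK.1)).2
    rw [hx2, dist_comm (ψ x)] at h3
    have h4 : L * dist w (ψ x) < L * (η / L * q) := by gcongr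
    have h5 : L * (η / L * q) = η * q := by field_simp
    linarith

theorem tendsto_natCast_rpow_neg (hd : 1 ≤ d) :
    Tendsto (fun N : ℕ => (N : ℝ) ^ (-(1 / (d : ℝ)))) atTop (𝓝[>] 0) := by
  have hd0 : (0 : ℝ) < d := by exact_mod_cast hd
  refine tendsto_nhdsWithin_iff.2 ⟨(tendsto_rpow_neg_atTop (by positivity)).comp
    tendsto_natCast_atTop_atTop, ?_⟩
  filter_upwards [eventually_gt_atTop 0] with N hN
  have : (0 : ℝ) < N := by exact_mod_cast hN
  exact Real.rpow_pos_of_pos this _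

/-- Most points of a configuration of bounded normalized energy can be moved to a prescribed
compact subset of almost full measure, moving points by little and not shrinking distances
much. -/
theorem exists_move (hd : 1 ≤ d) (hs : 0 < s) {A : Set (EuclideanSpace ℝ (Fin d'))}
    (hA : IsRectifiableManifold d d' A) {M ε : ℝ} (hM : 0 ≤ M) (hε : 0 < ε) (hε1 : ε < 1) :
    ∃ δ : ℝ, 0 < δ ∧ ∀ A' : Set (EuclideanSpace ℝ (Fin d')), IsClosed A' →
      (normHausdorff d d').real (A \ A') ≤ δ → ∀ ρ > 0, ∀ᶠ N : ℕ in atTop,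
      ∀ ω : Finset (EuclideanSpace ℝ (Fin d')), ↑ω ⊆ A → ω.card = N →
        energy s ω id ≤ M * (N : ℝ) ^ (1 + s / d) →
        ∃ ω₁ ⊆ ω, (1 - ε) * N ≤ ω₁.card ∧
          ∃ π : EuclideanSpace ℝ (Fin d') → EuclideanSpace ℝ (Fin d'),
            (∀ x ∈ ω₁, π x ∈ A' ∧ dist (π x) x ≤ ρ) ∧
            ∀ x ∈ ω₁, ∀ y ∈ ω₁, (1 - ε) * dist x y ≤ dist (π x) (π y) := by
  have hd0 : (0 : ℝ) < d := by exact_mod_cast hd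
  have hfin := normHausdorff_lt_top hA
  obtain ⟨n, K, φ, hK, hφ, hAK⟩ := hA
  set κ := (ε / (2 * (M + 1))) ^ (1 / s) with hκ
  have hκ0 : 0 < κ := by positivity
  have hκs : M * κ ^ s ≤ ε / 2 := by
    rw [hκ, ← Real.rpow_mul (by positivity), one_div_mul_cancel hs.ne', Real.rpow_one,
      mul_div_assoc', div_le_div_iff₀ (by positivity) (by positivity)]
    nlinarith
  set η := ε * κ / 2 with hη
  have hη0 : 0 < η := by positivity
  have hηκ : 2 * η ≤ κ := by rw [hη]; nlinarith
  set τ := ε / (2 * (n + 1)) with hτ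
  have hτ0 : 0 < τ := by positivity
  have hKA : ∀ k, φ k '' K k ⊆ A := fun k => by rw [hAK]; exact subset_iUnion (fun k => φ k '' K k) k
  have hchart : ∀ k, ∃ δ : ℝ, 0 < δ ∧ ∀ A' : Set (EuclideanSpace ℝ (Fin d')), IsClosed A' →
      (normHausdorff d d').real (φ k '' K k \ A') ≤ δ → ∀ᶠ q : ℝ in 𝓝[>] 0,
      ∀ ω : Finset (EuclideanSpace ℝ (Fin d')), ↑ω ⊆ φ k '' K k →
        (∀ x ∈ ω, ∀ y ∈ ω, x ≠ y → κ * q ≤ dist x y) →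
        (∀ x ∈ ω, ∀ z ∈ A', η * q < dist x z) → (ω.card : ℝ) * q ^ d ≤ τ := by
    intro k
    obtain ⟨G, L, -, hKG, hL, h⟩ := hφ k
    exact exists_card_far_le (hK k) hKG hL h
      ((measure_mono (hKA k)).trans_lt hfin).ne hη0 hηκ hτ0
  choose δ' hδ'0 hδ' using hchart
  obtain ⟨δ, hδle, hδ0⟩ : ∃ δ : ℝ, (∀ k, δ ≤ δ' k) ∧ 0 < δ := by
    have h1 : ∀ᶠ δ : ℝ in 𝓝[>] 0, ∀ k, δ ≤ δ' k :=
      eventually_all.2 fun k => (ge_mem_nhds (hδ'0 k)).filter_mono nhdsWithin_le_nhds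
    have h2 : ∀ᶠ δ : ℝ in 𝓝[>] 0, 0 < δ := self_mem_nhdsWithin
    exact (h1.and h2).exists
  refine ⟨δ, hδ0, fun A' hA' hAA' ρ hρ => ?_⟩
  have hq := tendsto_natCast_rpow_neg hd
  have hev : ∀ᶠ q : ℝ in 𝓝[>] 0, ∀ k, ∀ ω : Finset (EuclideanSpace ℝ (Fin d')),
      ↑ω ⊆ φ k '' K k → (∀ x ∈ ω, ∀ y ∈ ω, x ≠ y → κ * q ≤ dist x y) →
        (∀ x ∈ ω, ∀ z ∈ A', η * q < dist x z) → (ω.card : ℝ) * q ^ d ≤ τ := by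
    refine eventually_all.2 fun k => hδ' k A' hA' ?_
    refine (measureReal_mono (sdiff_subset_sdiff_left (hKA k)) ?_).trans (hAA'.trans (hδle k))
    exact ((measure_mono sdiff_subset).trans_lt hfin).ne
  have hρev : ∀ᶠ q : ℝ in 𝓝[>] 0, η * q ≤ ρ := by
    have h1 : Tendsto (fun q : ℝ => η * q) (𝓝[>] 0) (𝓝 (η * 0)) :=
      (Continuous.tendsto (by fun_prop) 0).mono_left nhdsWithin_le_nhds
    rw [mul_zero] at h1
    exact h1.eventually_le_const hρ
  filter_upwards [hq.eventually hev, hq.eventually hρev, eventually_gt_atTop 0]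
    with N hN1 hN2 hN3 ω hωA hωN hωE
  have hN0 : (0 : ℝ) < N := by exact_mod_cast hN3
  set q := (N : ℝ) ^ (-(1 / (d : ℝ))) with hqdef
  have hq0 : 0 < q := Real.rpow_pos_of_pos hN0 _
  have hqd : q ^ d = (N : ℝ)⁻¹ := by
    rw [hqdef, ← Real.rpow_natCast, ← Real.rpow_mul hN0.le]
    rw [show -(1 / (d : ℝ)) * d = -1 by field_simp, Real.rpow_neg_one]
  set close := ω.filter fun x => ∃ y ∈ ω, x ≠ y ∧ dist x y < κ * q with hclose
  set far := ω.filter fun x => x ∉ close ∧ ∀ z ∈ A', η * q < dist x z with hfar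
  have hclose_card : (close.card : ℝ) ≤ ε / 2 * N := by
    have h1 := card_close_mul_le_energy (I := ω) (J := close) (x := id) hs.le
      (fun _ _ _ _ h => h) (Finset.filter_subset _ _) (ρ := κ * q)
      (fun x hx => (Finset.mem_filter.1 hx).2)
    have h2 := h1.trans hωE
    have h3 : (κ * q) ^ (-s) = (κ ^ s)⁻¹ * (N : ℝ) ^ (s / d) := by
      rw [Real.mul_rpow hκ0.le hq0.le, Real.rpow_neg hκ0.le, hqdef, ← Real.rpow_mul hN0.le]
      congr 2
      ring
    rw [h3, Real.rpow_add hN0, Real.rpow_one] at h2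
    have h4 : (0 : ℝ) < (N : ℝ) ^ (s / d) := Real.rpow_pos_of_pos hN0 _
    have h5 : (0 : ℝ) < κ ^ s := by positivity
    have h6 : (close.card : ℝ) * (κ ^ s)⁻¹ ≤ M * N := by
      refine le_of_mul_le_mul_right ?_ h4
      linarith
    rw [mul_inv_le_iff₀ h5] at h6
    nlinarith
  have hfar_sub : ∀ x ∈ far, x ∈ ω ∧ x ∉ close ∧ ∀ z ∈ A', η * q < dist x z :=
    fun x hx => Finset.mem_filter.1 hx
  have hnc : ∀ x ∈ ω, x ∉ close → ∀ y ∈ ω, x ≠ y → κ * q ≤ dist x y := by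
    intro x hx hxc y hy hne
    by_contra! h
    exact hxc (Finset.mem_filter.2 ⟨hx, y, hy, hne, h⟩)
  have hfar_card : (far.card : ℝ) ≤ ε / 2 * N := by
    have h1 : far ⊆ Finset.univ.biUnion fun k => far.filter fun x => x ∈ φ k '' K k := by
      intro x hx
      have h2 := hωA (Finset.mem_coe.2 (hfar_sub x hx).1)
      rw [hAK] at h2
      obtain ⟨k, hk⟩ := mem_iUnion.1 h2
      exact Finset.mem_biUnion.2 ⟨k, Finset.mem_univ _, Finset.mem_filter.2 ⟨hx, hk⟩⟩
    have h2 : ∀ k, ((far.filter fun x => x ∈ φ k '' K k).card : ℝ) ≤ τ * N := by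
      intro k
      have h3 := hN1 k (far.filter fun x => x ∈ φ k '' K k)
        (fun x hx => (Finset.mem_filter.1 (Finset.mem_coe.1 hx)).2)
        (fun x hx y hy hne => by
          have hx1 := hfar_sub x (Finset.mem_filter.1 hx).1
          have hy1 := hfar_sub y (Finset.mem_filter.1 hy).1
          exact hnc x hx1.1 hx1.2.1 y hy1.1 hne)
        (fun x hx => (hfar_sub x (Finset.mem_filter.1 hx).1).2.2)
      rwa [hqd, mul_inv_le_iff₀ hN0] at h3
    have h4 : (far.card : ℝ) ≤ ∑ k : Fin n, ((far.filter fun x => x ∈ φ k '' K k).card : ℝ) := by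
      exact_mod_cast (Finset.card_le_card h1).trans Finset.card_biUnion_le
    refine h4.trans ((Finset.sum_le_sum fun k _ => h2 k).trans ?_)
    rw [Finset.sum_const, Finset.card_univ, Fintype.card_fin, nsmul_eq_mul, hτ]
    have h5 : (n : ℝ) * (ε / (2 * (n + 1))) ≤ ε / 2 := by
      rw [mul_div_assoc', div_le_div_iff₀ (by positivity) (by positivity)]
      nlinarith
    nlinarith
  have hπ : ∀ x, ∃ z, (∃ z ∈ A', dist x z ≤ η * q) → z ∈ A' ∧ dist x z ≤ η * q := by
    intro x
    by_cases h : ∃ z ∈ A', dist x z ≤ η * q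
    · obtain ⟨z, hz⟩ := h
      exact ⟨z, fun _ => hz⟩
    · exact ⟨x, fun h' => (h h').elim⟩
  choose π hπ using hπ
  have hω₁ : ∀ x ∈ (ω \ close) \ far, x ∈ ω ∧ x ∉ close ∧ π x ∈ A' ∧ dist x (π x) ≤ η * q := by
    intro x hx
    rw [Finset.mem_sdiff, Finset.mem_sdiff] at hx
    obtain ⟨⟨h1, h2⟩, h3⟩ := hx
    refine ⟨h1, h2, hπ x ?_⟩
    by_contra! h
    exact h3 (Finset.mem_filter.2 ⟨h1, h2, h⟩)
  refine ⟨(ω \ close) \ far, fun x hx => (hω₁ x hx).1, ?_, π, fun x hx => ?_,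
    fun x hx y hy => ?_⟩
  · have h1 := Finset.le_card_sdiff close ω
    have h2 := Finset.le_card_sdiff far (ω \ close)
    have h3 : ω.card ≤ ((ω \ close) \ far).card + far.card + close.card := by omega
    have h4 : (N : ℝ) ≤ ((ω \ close) \ far).card + far.card + close.card := by
      rw [← hωN]; exact_mod_cast h3
    linarith
  · obtain ⟨-, -, h1, h2⟩ := hω₁ x hx
    exact ⟨h1, by rw [dist_comm]; exact h2.trans hN2⟩
  · obtain ⟨hx1, hx2, -, hx3⟩ := hω₁ x hx
    obtain ⟨hy1, -, -, hy3⟩ := hω₁ y hy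
    by_cases hne : x = y
    · simp [hne]
    have h1 := hnc x hx1 hx2 y hy1 hne
    have h2 := dist_triangle4 x (π x) (π y) y
    rw [dist_comm (π y) y] at h2
    have h3 : ε * (κ * q) ≤ ε * dist x y := by gcongr
    have h4 : 2 * (η * q) = ε * (κ * q) := by rw [hη]; ring
    linarith

end Move

section UpperBound

variable {d d' : ℕ} {s : ℝ}

theorem exists_pos_le_dist_of_disjoint {X : Type*} [MetricSpace X] {B : ℕ → Set X}
    (hB : ∀ i, IsCompact (B i)) (hdisj : Pairwise (Function.onFun Disjoint B)) (n : ℕ) :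
    ∃ D : ℝ, 0 < D ∧ ∀ i ∈ Finset.range n, ∀ j ∈ Finset.range n, i ≠ j →
      ∀ x ∈ B i, ∀ y ∈ B j, D ≤ dist x y := by
  have h1 : ∀ i ∈ Finset.range n, ∀ j ∈ Finset.range n, ∀ᶠ D : ℝ in 𝓝[>] 0, i ≠ j →
      ∀ x ∈ B i, ∀ y ∈ B j, D ≤ dist x y := by
    intro i _ j _
    by_cases hij : i = j
    · exact Eventually.of_forall fun D h => (h hij).elim
    obtain ⟨r, hr0, hr⟩ := Metric.exists_pos_forall_lt_edist (hB i) (hB j).isClosed (hdisj hij)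
    filter_upwards [(ge_mem_nhds (NNReal.coe_pos.2 hr0)).filter_mono nhdsWithin_le_nhds]
      with D hD _ x hx y hy
    have h2 := hr x hx y hy
    rw [edist_nndist, ENNReal.coe_lt_coe] at h2
    exact hD.trans (NNReal.coe_le_coe.2 h2.le)
  have h2 : ∀ᶠ D : ℝ in 𝓝[>] 0, ∀ i ∈ Finset.range n, ∀ j ∈ Finset.range n, i ≠ j →
      ∀ x ∈ B i, ∀ y ∈ B j, D ≤ dist x y :=
    (Filter.eventually_all_finset _).2 fun i hi =>
      (Filter.eventually_all_finset _).2 fun j hj => h1 i hi j hj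
  have h3 : ∀ᶠ D : ℝ in 𝓝[>] 0, 0 < D := self_mem_nhdsWithin
  exact (h3.and h2).exists

theorem IsAlmostIsometryOn.isCompact_image {X : Type*} [MetricSpace X] {ε : ℝ} (hε : 0 ≤ ε)
    {g : X → EuclideanSpace ℝ (Fin d)} {B : Set X} (hB : IsCompact B)
    (h : IsAlmostIsometryOn ε g B) : IsCompact (g '' B) := by
  have h1 : LipschitzOnWith ⟨1 + ε, by linarith⟩ g B :=
    LipschitzOnWith.of_dist_le_mul fun x hx y hy => (h x hx y hy).2
  exact hB.image_of_continuousOn h1.continuousOn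

/-- Pulling back configurations along almost isometries and taking their union. -/
theorem exists_union_energy_le {X : Type*} [MetricSpace X] [Nonempty X] (hs : 0 ≤ s) {ε : ℝ}
    (hε : 0 ≤ ε) {n : ℕ} {B : ℕ → Set X} {g : ℕ → X → EuclideanSpace ℝ (Fin d)}
    (hdisj : Pairwise (Function.onFun Disjoint B)) (hg : ∀ i, IsAlmostIsometryOn ε (g i) (B i))
    {D : ℝ} (hD : 0 < D) (hDB : ∀ i ∈ Finset.range n, ∀ j ∈ Finset.range n, i ≠ j →
      ∀ x ∈ B i, ∀ y ∈ B j, D ≤ dist x y)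
    {ω : ℕ → Finset (EuclideanSpace ℝ (Fin d))} (hω : ∀ i, ↑(ω i) ⊆ g i '' B i) :
    ∃ Ω : Finset X, ↑Ω ⊆ (⋃ i, B i) ∧ Ω.card = ∑ i ∈ Finset.range n, (ω i).card ∧
      energy s Ω id ≤ (1 + ε) ^ s * ∑ i ∈ Finset.range n, energy s (ω i) id +
        (Ω.card : ℝ) ^ 2 * D ^ (-s) := by
  set ψ : ℕ → EuclideanSpace ℝ (Fin d) → X := fun i => Function.invFunOn (g i) (B i)
  have hψ : ∀ i, ∀ y ∈ ω i, ψ i y ∈ B i ∧ g i (ψ i y) = y := fun i y hy =>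
    ⟨Function.invFunOn_mem (hω i hy), Function.invFunOn_eq (hω i hy)⟩
  have hinj : ∀ i, Set.InjOn (ψ i) (ω i) := by
    intro i x hx y hy h
    rw [← (hψ i x hx).2, h, (hψ i y hy).2]
  have huniq : ∀ i j x, x ∈ B i → x ∈ B j → i = j := by
    intro i j x hi hj
    by_contra hij
    exact Set.disjoint_left.1 (hdisj hij) hi hj
  have hc : ∀ x, ∃ k, ∀ i, x ∈ B i → k = i := by
    intro x
    by_cases h : ∃ i, x ∈ B i
    · obtain ⟨i, hi⟩ := h
      exact ⟨i, fun j hj => huniq i j x hi hj⟩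
    · exact ⟨0, fun i hi => (h ⟨i, hi⟩).elim⟩
  choose c hc using hc
  set Ω := (Finset.range n).biUnion fun i => (ω i).image (ψ i) with hΩ
  have hmem : ∀ x ∈ Ω, ∃ i ∈ Finset.range n, ∃ y ∈ ω i, ψ i y = x := by
    intro x hx
    obtain ⟨i, hi, hx⟩ := Finset.mem_biUnion.1 hx
    obtain ⟨y, hy, hyx⟩ := Finset.mem_image.1 hx
    exact ⟨i, hi, y, hy, hyx⟩
  have hmemB : ∀ x ∈ Ω, c x ∈ Finset.range n ∧ x ∈ B (c x) := by
    intro x hx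
    obtain ⟨i, hi, y, hy, rfl⟩ := hmem x hx
    have h1 := (hψ i y hy).1
    rw [hc _ i h1]
    exact ⟨hi, h1⟩
  have hfiber : ∀ k ∈ Finset.range n, (Ω.filter fun x => c x = k) = (ω k).image (ψ k) := by
    intro k hk
    ext x
    rw [Finset.mem_filter]
    constructor
    · rintro ⟨hx, hxk⟩
      obtain ⟨i, hi, y, hy, rfl⟩ := hmem x hx
      have h1 : i = k := (hc _ i (hψ i y hy).1).symm.trans hxk
      subst h1
      exact Finset.mem_image_of_mem _ hy
    · intro hx
      obtain ⟨y, hy, rfl⟩ := Finset.mem_image.1 hx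
      exact ⟨Finset.mem_biUnion.2 ⟨k, hk, hx⟩, hc _ k (hψ k y hy).1⟩
  refine ⟨Ω, fun x hx => mem_iUnion.2 ⟨c x, (hmemB x hx).2⟩, ?_, ?_⟩
  · rw [hΩ, Finset.card_biUnion]
    · exact Finset.sum_congr rfl fun i _ => Finset.card_image_of_injOn (hinj i)
    · intro i _ j _ hij
      refine Finset.disjoint_left.2 fun x hx hx' => ?_
      obtain ⟨y, hy, rfl⟩ := Finset.mem_image.1 hx
      obtain ⟨z, hz, hzy⟩ := Finset.mem_image.1 hx'
      exact hij (huniq i j _ (hψ i y hy).1 (hzy ▸ (hψ j z hz).1))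
  · have h1 := energy_le_sum_energy_fiber (s := s) (I := Ω) (x := id) (c := c)
      (T := Finset.range n) hs (fun x hx => (hmemB x hx).1) hD (fun x hx y hy hne =>
        hDB _ (hmemB x hx).1 _ (hmemB y hy).1 hne x (hmemB x hx).2 y (hmemB y hy).2)
    refine h1.trans ?_
    rw [Finset.mul_sum]
    gcongr with i hi
    rw [hfiber i hi, energy_image (hinj i)]
    have h2 := energy_le_of_dist_le (s := s) (c := (1 + ε)⁻¹) (I := ω i) (x := id) (y := ψ i) hs
      (by positivity) (fun _ _ _ _ h => h) (fun x hx y hy _ => by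
        have h3 := (hg i _ (hψ i x hx).1 _ (hψ i y hy).1).2
        rw [(hψ i x hx).2, (hψ i y hy).2] at h3
        rwa [inv_mul_le_iff₀ (by positivity)])
    rwa [Real.inv_rpow (by positivity), ← Real.rpow_neg (by positivity), neg_neg] at h2

theorem mul_volume_rpow_le (hd : 1 ≤ d) (hs : (d : ℝ) < s) {c n₀ : ℝ} (hn₀ : 0 < n₀)
    (hfill : ∀ K : Set (EuclideanSpace ℝ (Fin d)), IsCompact K →
      ∃ (ω : ℝ → Finset (EuclideanSpace ℝ (Fin d))) (u : ℝ → ℝ), (∀ t > 0, ↑(ω t) ⊆ K) ∧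
        Tendsto (fun t => ((ω t).card : ℝ) * t ^ d) (𝓝[>] 0) (𝓝 (n₀ * volume.real K)) ∧
        Tendsto u (𝓝[>] 0) (𝓝 (c * n₀ ^ (1 + s / d) * volume.real K)) ∧
        ∀ t > 0, energy s (ω t) id * t ^ ((d : ℝ) + s) ≤ u t)
    {X : Type*} [MetricSpace X] [Nonempty X] {A : Set X} {ℓ : ℝ}
    (hℓ : ∀ ε > 0, ∃ N₀ : ℕ, ∀ ω : Finset X, ↑ω ⊆ A → N₀ ≤ ω.card →
      (ℓ - ε) * (ω.card : ℝ) ^ (1 + s / d) ≤ energy s ω id) {ε : ℝ} (hε : 0 ≤ ε)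
    {n : ℕ} {B : ℕ → Set X} {g : ℕ → X → EuclideanSpace ℝ (Fin d)} (hB : ∀ i, IsCompact (B i))
    (hBA : ∀ i, B i ⊆ A) (hdisj : Pairwise (Function.onFun Disjoint B))
    (hg : ∀ i, IsAlmostIsometryOn ε (g i) (B i))
    (hV : 0 < ∑ i ∈ Finset.range n, volume.real (g i '' B i)) :
    ℓ * (∑ i ∈ Finset.range n, volume.real (g i '' B i)) ^ (s / d) ≤ (1 + ε) ^ s * c := by
  choose ω u hωK hωcard hu hωu using fun i => hfill _ ((hg i).isCompact_image hε (hB i))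
  obtain ⟨D, hD, hDB⟩ := exists_pos_le_dist_of_disjoint hB hdisj n
  have hΩ : ∀ t : ℝ, ∃ Ω : Finset X, 0 < t → ↑Ω ⊆ A ∧
      Ω.card = ∑ i ∈ Finset.range n, (ω i t).card ∧
      energy s Ω id ≤ (1 + ε) ^ s * ∑ i ∈ Finset.range n, energy s (ω i t) id +
        (Ω.card : ℝ) ^ 2 * D ^ (-s) := by
    intro t
    by_cases ht : 0 < t
    · obtain ⟨Ω, h1, h2⟩ := exists_union_energy_le (d.cast_nonneg.trans hs.le) hε hdisj hg hD hDB
        (ω := fun i => ω i t) (fun i => hωK i t ht)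
      exact ⟨Ω, fun _ => ⟨h1.trans (iUnion_subset hBA), h2⟩⟩
    · exact ⟨∅, fun h => (ht h).elim⟩
  choose Ω hΩ using hΩ
  set V := ∑ i ∈ Finset.range n, volume.real (g i '' B i) with hVdef
  have hd0 : (0 : ℝ) < d := by exact_mod_cast hd
  have hpos : ∀ᶠ t : ℝ in 𝓝[>] 0, 0 < t := self_mem_nhdsWithin
  have hx : Tendsto (fun t => ((Ω t).card : ℝ) * t ^ d) (𝓝[>] 0) (𝓝 (n₀ * V)) := by
    have h1 := tendsto_finsetSum (Finset.range n) fun i _ => hωcard i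
    rw [← Finset.mul_sum] at h1
    refine h1.congr' ?_
    filter_upwards [hpos] with t ht
    rw [(hΩ t ht).2.1, Nat.cast_sum, Finset.sum_mul]
  have hcard : Tendsto (fun t => ((Ω t).card : ℝ)) (𝓝[>] 0) atTop := by
    have h1 : Tendsto (fun t : ℝ => t ^ d) (𝓝[>] 0) (𝓝[>] 0) := by
      refine tendsto_nhdsWithin_iff.2 ⟨?_, ?_⟩
      · have h2 : Tendsto (fun t : ℝ => t ^ d) (𝓝 0) (𝓝 (0 ^ d)) := (continuous_pow d).tendsto 0
        rw [zero_pow (by omega)] at h2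
        exact h2.mono_left nhdsWithin_le_nhds
      · filter_upwards [hpos] with t ht
        exact pow_pos ht d
    have h2 := (hx.pos_mul_atTop (by positivity) (tendsto_inv_nhdsGT_zero.comp h1))
    refine h2.congr' ?_
    filter_upwards [hpos] with t ht
    simp only [Function.comp]
    field_simp
  have hup : Tendsto (fun t => (1 + ε) ^ s * ∑ i ∈ Finset.range n, u i t +
      (((Ω t).card : ℝ) * t ^ d) ^ 2 * D ^ (-s) * t ^ (s - d)) (𝓝[>] 0)
      (𝓝 ((1 + ε) ^ s * ∑ i ∈ Finset.range n, c * n₀ ^ (1 + s / d) * volume.real (g i '' B i) +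
        (n₀ * V) ^ 2 * D ^ (-s) * 0)) := by
    refine ((tendsto_finsetSum _ fun i _ => hu i).const_mul _).add
      (((hx.pow 2).mul_const _).mul ?_)
    have h2 : Tendsto (fun t : ℝ => t ^ (s - d)) (𝓝 0) (𝓝 (0 ^ (s - d))) :=
      (Real.continuousAt_rpow_const _ _ (Or.inr (by linarith))).tendsto
    rw [Real.zero_rpow (by linarith)] at h2
    exact h2.mono_left nhdsWithin_le_nhds
  rw [← Finset.mul_sum, ← hVdef, mul_zero, add_zero] at hup
  have hkey : ∀ η > 0, (ℓ - η) * V ^ (s / d) ≤ (1 + ε) ^ s * c := by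
    intro η hη
    obtain ⟨N₀, hN₀⟩ := hℓ η hη
    have hlow : Tendsto (fun t => (ℓ - η) * (((Ω t).card : ℝ) * t ^ d) ^ (1 + s / d)) (𝓝[>] 0)
        (𝓝 ((ℓ - η) * (n₀ * V) ^ (1 + s / d))) :=
      (hx.rpow_const (Or.inl (by positivity))).const_mul _
    have h1 := le_of_tendsto_of_tendsto hlow hup ?_
    · rw [Real.mul_rpow hn₀.le hV.le, Real.rpow_add hV, Real.rpow_one] at h1
      have h2 : 0 < n₀ ^ (1 + s / d) * V := by positivity
      refine le_of_mul_le_mul_right ?_ h2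
      linarith
    · filter_upwards [hpos, hcard.eventually_ge_atTop (N₀ : ℝ)] with t ht hN
      obtain ⟨hA, -, hE⟩ := hΩ t ht
      have h2 := hN₀ (Ω t) hA (by exact_mod_cast hN)
      have hpow : ∀ a : ℝ, 0 ≤ a → (a * t ^ d) ^ (1 + s / d) = a ^ (1 + s / d) * t ^ (d + s) := by
        intro a ha
        rw [Real.mul_rpow ha (by positivity), ← Real.rpow_natCast, ← Real.rpow_mul ht.le]
        congr 2
        field_simp
      have h3 : ((Ω t).card : ℝ) ^ 2 * t ^ (d + s) =
          (((Ω t).card : ℝ) * t ^ d) ^ 2 * t ^ (s - d) := by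
        rw [mul_pow, mul_assoc, ← pow_mul, ← Real.rpow_natCast t, ← Real.rpow_add ht]
        congr 2
        push_cast
        ring
      rw [hpow _ (Nat.cast_nonneg _)]
      calc (ℓ - η) * (((Ω t).card : ℝ) ^ (1 + s / d) * t ^ (d + s))
          = (ℓ - η) * ((Ω t).card : ℝ) ^ (1 + s / d) * t ^ (d + s) := by ring
        _ ≤ ((1 + ε) ^ s * ∑ i ∈ Finset.range n, energy s (ω i t) id +
            ((Ω t).card : ℝ) ^ 2 * D ^ (-s)) * t ^ (d + s) := by
            gcongr
            exact h2.trans hE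
        _ = (1 + ε) ^ s * ∑ i ∈ Finset.range n, energy s (ω i t) id * t ^ (d + s) +
            ((Ω t).card : ℝ) ^ 2 * t ^ (d + s) * D ^ (-s) := by
            rw [← Finset.sum_mul]
            ring
        _ ≤ _ := by
            rw [h3]
            have h4 : ∀ i ∈ Finset.range n, energy s (ω i t) id * t ^ (d + s) ≤ u i t :=
              fun i _ => hωu i t ht
            have h5 := mul_le_mul_of_nonneg_left (Finset.sum_le_sum h4)
              (show 0 ≤ (1 + ε) ^ s by positivity)
            linarith
  have h6 : Tendsto (fun η : ℝ => (ℓ - η) * V ^ (s / d)) (𝓝[>] 0) (𝓝 ((ℓ - 0) * V ^ (s / d))) :=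
    ((tendsto_id.const_sub ℓ).mul_const _).mono_left nhdsWithin_le_nhds
  rw [sub_zero] at h6
  exact le_of_tendsto h6 (by filter_upwards [hpos] with η hη using hkey η hη)

end UpperBound

section UpperBoundConst

variable {d d' : ℕ} {s : ℝ}

theorem IsAlmostIsometryOn.real_normHausdorff_le {ε : ℝ} (hε : 0 ≤ ε)
    {g : EuclideanSpace ℝ (Fin d') → EuclideanSpace ℝ (Fin d)}
    {B : Set (EuclideanSpace ℝ (Fin d'))} (hB : IsCompact B) (hg : IsAlmostIsometryOn ε g B) :
    (normHausdorff d d').real B ≤ (1 + ε) ^ d * volume.real (g '' B) := by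
  have hinj : Set.InjOn g B := by
    intro x hx y hy h
    have h1 := (hg x hx y hy).1
    rw [h, dist_self, mul_zero] at h1
    exact dist_le_zero.1 h1
  have h1 : Function.invFunOn g B '' (g '' B) = B := hinj.invFunOn_image subset_rfl
  have h2 := real_normHausdorff_image_le (d' := d') (f := Function.invFunOn g B)
    (hg.isCompact_image hε hB).measure_lt_top.ne (c := 1 + ε) (by positivity) (by
      rintro _ ⟨x, hx, rfl⟩ _ ⟨y, hy, rfl⟩
      rw [hinj.leftInvOn_invFunOn hx, hinj.leftInvOn_invFunOn hy]
      exact (hg x hx y hy).1)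
  rwa [h1] at h2

/-- A constant that is not a lower bound for the cube bounds the normalized energy on
rectifiable manifolds from above. -/
theorem mul_real_rpow_le_of_not_isLowerConst (hd : 1 ≤ d) (hs : (d : ℝ) < s)
    {A : Set (EuclideanSpace ℝ (Fin d'))} (hA : IsRectifiableManifold d d' A)
    (hA0 : 0 < (normHausdorff d d').real A) {ℓ : ℝ} (hℓ0 : 0 ≤ ℓ)
    (hℓ : ∀ ε > 0, ∃ N₀ : ℕ, ∀ ω : Finset (EuclideanSpace ℝ (Fin d')), ↑ω ⊆ A → N₀ ≤ ω.card →
      (ℓ - ε) * (ω.card : ℝ) ^ (1 + s / d) ≤ energy s ω id) {c : ℝ} (hc0 : 0 ≤ c)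
    (hc : ¬ IsLowerConst d s c) : ℓ * (normHausdorff d d').real A ^ (s / d) ≤ c := by
  set h := normHausdorff d d'
  have hfin : h A ≠ ∞ := (normHausdorff_lt_top hA).ne
  have hne : A.Nonempty := by
    rw [nonempty_iff_ne_empty]
    rintro rfl
    simp at hA0
  have hd0 : (0 : ℝ) < d := by exact_mod_cast hd
  have hp : 0 < s / d := div_pos (hd0.trans hs) hd0
  refine le_of_forall_gt_imp_ge_of_dense fun c' hcc => ?_
  obtain ⟨n₀, hn₀, hfill⟩ := exists_filling hd hs hc0 hc hcc
  have key : ∀ᶠ ε : ℝ in 𝓝[>] 0,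
      ℓ * (((1 + ε) ^ d)⁻¹ * (h.real A - ε)) ^ (s / d) ≤ (1 + ε) ^ s * c' := by
    filter_upwards [self_mem_nhdsWithin, (gt_mem_nhds hA0).filter_mono nhdsWithin_le_nhds]
      with ε hε hεA
    have hε : 0 < ε := hε
    obtain ⟨n, B, g, hB, hBA, hdisj, -, hg, hδ⟩ := exists_decomposition hA hne hε one_pos hε
    have hV : ((1 + ε) ^ d)⁻¹ * (h.real A - ε) ≤
        ∑ i ∈ Finset.range n, volume.real (g i '' B i) := by
      rw [inv_mul_le_iff₀ (by positivity), Finset.mul_sum]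
      have h1 : h.real A ≤ h.real (A \ ⋃ i ∈ Finset.range n, B i) +
          h.real (⋃ i ∈ Finset.range n, B i) := by
        have hU : (⋃ i ∈ Finset.range n, B i) ⊆ A := iUnion₂_subset fun i _ => hBA i
        refine le_trans (le_of_eq ?_) (measureReal_union_le _ _)
        rw [sdiff_union_self, union_eq_self_of_subset_right hU]
      have h2 := measureReal_biUnion_finset_le (μ := h) (Finset.range n) B
      have h3 := Finset.sum_le_sum fun i (_ : i ∈ Finset.range n) =>
        (hg i).real_normHausdorff_le hε.le (hB i)
      linarith
    have h0 : 0 < ((1 + ε) ^ d)⁻¹ * (h.real A - ε) :=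
      mul_pos (by positivity) (sub_pos.2 hεA)
    have h4 := mul_volume_rpow_le hd hs hn₀ hfill hℓ hε.le hB hBA hdisj hg (h0.trans_le hV)
    refine le_trans ?_ h4
    gcongr
  have hcont : ∀ {f : ℝ → ℝ}, ContinuousAt f 0 → Tendsto f (𝓝[>] 0) (𝓝 (f 0)) :=
    fun hf => hf.tendsto.mono_left nhdsWithin_le_nhds
  have l1 := hcont (f := fun ε => ℓ * (((1 + ε) ^ d)⁻¹ * (h.real A - ε)) ^ (s / d)) (by
    refine continuousAt_const.mul (ContinuousAt.rpow_const (ContinuousAt.mul ?_ (by fun_prop))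
      (Or.inr hp.le))
    exact ContinuousAt.inv₀ (by fun_prop) (by simp))
  have l2 := hcont (f := fun ε => (1 + ε) ^ s * c') (by
    refine ContinuousAt.mul (ContinuousAt.rpow_const (by fun_prop) (Or.inl (by simp))) (by fun_prop))
  have := le_of_tendsto_of_tendsto l1 l2 key
  simpa using this

end UpperBoundConst

section WeightedLowerBound

variable {d d' : ℕ} {s : ℝ}

theorem rpow_tangent_le {p n β v : ℝ} (hp : 0 < p) (hn : 0 ≤ n) (hβ : 0 < β) (hv : 0 ≤ v) :
    (1 + p) * v ^ p * n - p * β * v ^ (1 + p) ≤ n ^ (1 + p) * β ^ (-p) := by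
  have hpq : (1 + p).HolderConjugate ((1 + p) / p) := by
    rw [Real.holderConjugate_iff]
    refine ⟨by linarith, ?_⟩
    field_simp
  have h1 := Real.young_inequality_of_nonneg (div_nonneg hn hβ.le) (Real.rpow_nonneg hv p) hpq
  rw [← Real.rpow_mul hv, mul_div_cancel₀ _ hp.ne', Real.div_rpow hn hβ.le] at h1
  have h2 : β ^ (1 + p) = β / β ^ (-p) := by
    rw [Real.rpow_add hβ, Real.rpow_one, Real.rpow_neg hβ.le, div_inv_eq_mul]
  rw [h2] at h1
  have h3 : 0 < β ^ (-p) := by positivity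
  have h4 := mul_le_mul_of_nonneg_left h1 (show 0 ≤ (1 + p) * β by positivity)
  have h5 : (1 + p) * β * (n ^ (1 + p) / (β / β ^ (-p)) / (1 + p) +
      v ^ (1 + p) / ((1 + p) / p)) = n ^ (1 + p) * β ^ (-p) + p * β * v ^ (1 + p) := by
    field_simp
  have h6 : (1 + p) * β * (n / β * v ^ p) = (1 + p) * v ^ p * n := by
    field_simp
  linarith

theorem exists_color {X : Type*} {B : ℕ → Set X} (hdisj : Pairwise (Function.onFun Disjoint B))
    (n : ℕ) : ∃ c : X → ℕ, ∀ x, ∀ i ∈ Finset.range n, c x = i ↔ x ∈ B i := by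
  suffices h : ∀ x, ∃ k, ∀ i ∈ Finset.range n, k = i ↔ x ∈ B i from ⟨_, fun x => (h x).choose_spec⟩
  intro x
  by_cases hx : ∃ k, x ∈ B k
  · obtain ⟨k, hk⟩ := hx
    refine ⟨k, fun i _ => ⟨fun h => h ▸ hk, fun hi => ?_⟩⟩
    by_contra hne
    exact Set.disjoint_left.1 (hdisj hne) hk hi
  · exact ⟨n, fun i hi =>
      ⟨fun h => ((Finset.mem_range.1 hi).ne' h).elim, fun h => (hx ⟨i, h⟩).elim⟩⟩

theorem IsLowerConst.exists_weighted_le_energy {X : Type*} [MetricSpace X] {a : ℝ}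
    (ha : IsLowerConst d s a) (ha0 : 0 ≤ a) (hd : 1 ≤ d) (hs : 0 < s) {ε : ℝ} (hε : 0 ≤ ε)
    {B : ℕ → Set X} {g : ℕ → X → EuclideanSpace ℝ (Fin d)} (hB : ∀ i, IsCompact (B i))
    (hdisj : Pairwise (Function.onFun Disjoint B)) (hg : ∀ i, IsAlmostIsometryOn ε (g i) (B i))
    {ε' : ℝ} (hε' : 0 < ε') (n : ℕ) :
    ∃ b : ℝ, ∀ (Ω : Finset X) (T : ℝ) (w : ℕ → ℝ), 0 ≤ T → (∀ i, 0 ≤ w i) →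
      a * (T ^ (s / d) * ((1 + s / d) *
        (∑ i ∈ Finset.range n, w i * ((Ω.filter fun x => x ∈ B i).card : ℝ)) - s / d * T *
        ∑ i ∈ Finset.range n, (volume.real (g i '' B i) + ε') * (1 + ε) ^ d *
          w i ^ (1 + d / s))) ≤ energy s Ω id + b := by
  have hd0 : (0 : ℝ) < d := by exact_mod_cast hd
  have hp : 0 < s / d := div_pos hs hd0
  choose b hb0 hb using fun i => ha.le_energy_of_dist_le ha0 hd hs.le (B := B i) (g := g i)
    (c := 1 + ε) (by positivity) (fun x hx y hy => (hg i x hx y hy).1)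
    ((hg i).isCompact_image hε (hB i)) hε'
  set β : ℕ → ℝ := fun i => (volume.real (g i '' B i) + ε') * (1 + ε) ^ d
  have hβ : ∀ i, 0 < β i := fun i => by positivity
  obtain ⟨c, hc⟩ := exists_color hdisj n
  refine ⟨∑ i ∈ Finset.range n, β i ^ (-(s / d)) * b i, fun Ω T w hT hw => ?_⟩
  have hterm : ∀ i ∈ Finset.range n,
      a * (T ^ (s / d) * ((1 + s / d) * (w i * ((Ω.filter fun x => x ∈ B i).card : ℝ)) -
        s / d * T * (β i * w i ^ (1 + d / s)))) ≤
      energy s (Ω.filter fun x => c x = i) id + β i ^ (-(s / d)) * b i := by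
    intro i hi
    have hfilter : (Ω.filter fun x => c x = i) = Ω.filter fun x => x ∈ B i :=
      Finset.filter_congr fun x _ => hc x i hi
    have h1 := hb i (Ω.filter fun x => x ∈ B i) (fun x hx => (Finset.mem_filter.1 hx).2)
    rw [hfilter]
    set m : ℝ := ((Ω.filter fun x => x ∈ B i).card : ℝ) with hm
    have h2 := rpow_tangent_le hp (Nat.cast_nonneg _ : 0 ≤ m) (hβ i)
      (mul_nonneg hT (Real.rpow_nonneg (hw i) (d / s)))
    have h3 : (T * w i ^ (d / s)) ^ (s / d) = T ^ (s / d) * w i := by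
      rw [Real.mul_rpow hT (Real.rpow_nonneg (hw i) _), ← Real.rpow_mul (hw i)]
      congr 1
      rw [div_mul_div_cancel₀ hs.ne', div_self hd0.ne', Real.rpow_one]
    have h4 : (T * w i ^ (d / s)) ^ (1 + s / d) = T ^ (s / d) * T * w i ^ (1 + d / s) := by
      rw [add_comm, Real.rpow_add' (mul_nonneg hT (Real.rpow_nonneg (hw i) _)) (by positivity), h3,
        Real.rpow_one, Real.rpow_add' (hw i) (by positivity), Real.rpow_one]
      ring
    rw [h3, h4] at h2
    have h5 : (volume.real (g i '' B i) + ε') ^ (s / d) * (1 + ε) ^ s = β i ^ (s / d) := by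
      rw [Real.mul_rpow (by positivity) (by positivity), ← Real.rpow_natCast (1 + ε) d,
        ← Real.rpow_mul (by positivity), mul_div_cancel₀ _ hd0.ne']
    rw [← mul_assoc, h5] at h1
    have h6 := mul_le_mul_of_nonneg_left h1 (Real.rpow_nonneg (hβ i).le (-(s / d)))
    rw [mul_add, ← mul_assoc, ← mul_assoc, ← Real.rpow_add (hβ i), neg_add_cancel, Real.rpow_zero,
      one_mul] at h6
    have h7 := mul_le_mul_of_nonneg_left h2 ha0
    calc _ = a * ((1 + s / d) * (T ^ (s / d) * w i) * m -
          s / d * β i * (T ^ (s / d) * T * w i ^ (1 + d / s))) := by ring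
      _ ≤ _ := h7
      _ = β i ^ (-(s / d)) * a * m ^ (1 + s / d) := by ring
      _ ≤ _ := h6
  have h8 := Finset.sum_le_sum hterm
  rw [Finset.sum_add_distrib, ← Finset.mul_sum, ← Finset.mul_sum, Finset.sum_sub_distrib,
    ← Finset.mul_sum, ← Finset.mul_sum] at h8
  have h9 := sum_energy_fiber_le (s := s) Ω id c (Finset.range n)
  linarith

theorem sum_sub_le_sum_card {X : Type*} {B : ℕ → Set X}
    (hdisj : Pairwise (Function.onFun Disjoint B)) {n : ℕ} {Ω : Finset X}
    (hΩ : ↑Ω ⊆ ⋃ i ∈ Finset.range n, B i) {F : X → ℝ} {w : ℕ → ℝ}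
    (h : ∀ i, ∀ x ∈ B i, F x ≤ w i) :
    ∑ x ∈ Ω, F x ≤ ∑ i ∈ Finset.range n, w i * ((Ω.filter fun x => x ∈ B i).card : ℝ) := by
  obtain ⟨c, hc⟩ := exists_color hdisj n
  have hmap : ∀ x ∈ Ω, c x ∈ Finset.range n := by
    intro x hx
    obtain ⟨i, hi, hxi⟩ := mem_iUnion₂.1 (hΩ hx)
    rwa [(hc x i hi).2 hxi]
  rw [← Finset.sum_fiberwise_of_maps_to hmap]
  refine Finset.sum_le_sum fun i hi => ?_
  have hfilter : (Ω.filter fun x => c x = i) = Ω.filter fun x => x ∈ B i :=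
    Finset.filter_congr fun x _ => hc x i hi
  have h1 : ∑ x ∈ Ω.filter fun x => c x = i, F x ≤ ∑ x ∈ Ω.filter fun x => x ∈ B i, w i := by
    rw [hfilter]
    exact Finset.sum_le_sum fun x hx => h i x (Finset.mem_filter.1 hx).2
  rw [Finset.sum_const, nsmul_eq_mul, mul_comm] at h1
  exact h1

theorem sum_measureReal_mul_le_setIntegral {X : Type*} [MetricSpace X] [MeasurableSpace X]
    [BorelSpace X] {μ : Measure X} {A : Set X} (hA : IsCompact A) (hμ : μ A ≠ ∞) {F : X → ℝ}
    (hF : Continuous F) (hF0 : ∀ x, 0 ≤ F x) {B : ℕ → Set X} (hB : ∀ i, IsCompact (B i))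
    (hBA : ∀ i, B i ⊆ A) (hdisj : Pairwise (Function.onFun Disjoint B)) (n : ℕ) {ε : ℝ}
    (hε : 0 ≤ ε) {w : ℕ → ℝ} (hw : ∀ i, ∀ x ∈ B i, w i ≤ F x + ε) :
    ∑ i ∈ Finset.range n, μ.real (B i) * w i ≤ ∫ x in A, F x ∂μ + ε * μ.real A := by
  have hInt : IntegrableOn F A μ := by
    obtain ⟨C, hC⟩ := hA.exists_bound_of_continuousOn hF.continuousOn
    exact Measure.integrableOn_of_bounded hμ hF.aestronglyMeasurable
      ((ae_restrict_iff' hA.measurableSet).2 (Eventually.of_forall hC))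
  have hInt' : IntegrableOn (fun x => F x + ε) A μ := hInt.add (integrableOn_const hμ)
  have h1 : ∀ i ∈ Finset.range n, μ.real (B i) * w i ≤ ∫ x in B i, (F x + ε) ∂μ := by
    intro i _
    have hi : μ (B i) ≠ ∞ := measure_ne_top_of_subset (hBA i) hμ
    have h2 := setIntegral_mono_on (μ := μ) (integrableOn_const (C := w i) hi)
      (hInt'.mono_set (hBA i)) (hB i).measurableSet (hw i)
    rwa [setIntegral_const, smul_eq_mul] at h2
  refine (Finset.sum_le_sum h1).trans ?_
  rw [← integral_biUnion_finset _ (fun i _ => (hB i).measurableSet) (fun i _ j _ h => hdisj h)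
    (fun i _ => hInt'.mono_set (hBA i))]
  refine (setIntegral_mono_set hInt' (Eventually.of_forall fun x => add_nonneg (hF0 x) hε)
    (LE.le.eventuallyLE (iUnion₂_subset fun i _ => hBA i))).trans ?_
  rw [integral_add hInt (integrableOn_const hμ), setIntegral_const, smul_eq_mul, mul_comm]

end WeightedLowerBound

section WeightedMean

variable {d d' : ℕ} {s : ℝ}

theorem exists_pos_forall_dist_le_abs_sub_le {X : Type*} [MetricSpace X] {A : Set X}
    (hA : IsCompact A) {F : X → ℝ} (hF : Continuous F) {ε : ℝ} (hε : 0 < ε) :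
    ∃ r > 0, ∀ x ∈ A, ∀ y ∈ A, dist x y ≤ r → |F x - F y| ≤ ε := by
  obtain ⟨r, hr, h⟩ := Metric.uniformContinuousOn_iff.1
    (hA.uniformContinuousOn_of_continuous hF.continuousOn) ε hε
  refine ⟨r / 2, by positivity, fun x hx y hy hxy => ?_⟩
  exact (Real.dist_eq _ _ ▸ h x hx y hy (by linarith)).le

theorem weighted_sum_sub_le {X : Type*} [MetricSpace X] {A : Set X} {W : X → ℝ}
    (hW2 : ∀ x, W x ≤ 3 / 2) {ε : ℝ} (hε : 0 ≤ ε) {ω ω₁ : Finset X}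
    (hω : ω₁ ⊆ ω) (hωA : ↑ω ⊆ A) (hcard : (1 - ε) * ω.card ≤ ω₁.card) {π : X → X} {ρ : ℝ}
    (hπ : ∀ x ∈ ω₁, π x ∈ A ∧ dist (π x) x ≤ ρ)
    (hWρ : ∀ x ∈ A, ∀ y ∈ A, dist x y ≤ ρ → |W x - W y| ≤ ε) :
    ∑ x ∈ ω, W x - 4 * ε * ω.card ≤ ∑ x ∈ ω₁, (W (π x) - ε) := by
  have h1 : ∑ x ∈ ω₁, (W x - 2 * ε) ≤ ∑ x ∈ ω₁, (W (π x) - ε) := by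
    refine Finset.sum_le_sum fun x hx => ?_
    have h2 := (abs_le.1 (hWρ _ (hπ x hx).1 x (hωA (hω hx)) (hπ x hx).2)).1
    linarith
  rw [Finset.sum_sub_distrib, Finset.sum_const, nsmul_eq_mul] at h1
  have h2 : ∑ x ∈ ω \ ω₁, W x ≤ (ω \ ω₁).card * (3 / 2) := by
    rw [← nsmul_eq_mul]
    exact Finset.sum_le_card_nsmul _ _ _ fun x _ => hW2 x
  have h3 := Finset.sum_sdiff hω (f := W)
  have h4 : ((ω \ ω₁).card : ℝ) + ω₁.card = ω.card := by
    exact_mod_cast Finset.card_sdiff_add_card_eq_card hω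
  have h5 : (ω₁.card : ℝ) ≤ ω.card := by exact_mod_cast Finset.card_le_card hω
  have h6 := mul_le_mul_of_nonneg_left h5 hε
  have h7 : 0 ≤ ε * ω.card := by positivity
  linarith

theorem eventually_weighted_mean_sub_le (hd : 1 ≤ d) (hs : (d : ℝ) < s)
    {A : Set (EuclideanSpace ℝ (Fin d'))} (hA : IsRectifiableManifold d d' A)
    (hA0 : 0 < (normHausdorff d d').real A) {a : ℝ} (ha : IsLowerConst d s a) (ha0 : 0 ≤ a)
    {ω : ℕ → Finset (EuclideanSpace ℝ (Fin d'))} (hsub : ∀ N, ↑(ω N) ⊆ A)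
    (hcard : ∀ N, (ω N).card = N) {ℓ : ℝ} (hℓ : 0 ≤ ℓ)
    (hE : Tendsto (fun N : ℕ => energy s (ω N) id / (N : ℝ) ^ (1 + s / d)) atTop (𝓝 ℓ))
    {W : EuclideanSpace ℝ (Fin d') → ℝ} (hW : Continuous W) (hW1 : ∀ x, 0 ≤ W x)
    (hW2 : ∀ x, W x ≤ 3 / 2) {ε : ℝ} (hε : 0 < ε) (hε1 : ε < 1) :
    ∀ᶠ N : ℕ in atTop,
      a * ((1 + s / d) * ((1 / (N : ℝ)) * ∑ x ∈ ω N, W x - 4 * ε) - s / d *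
        (1 / (normHausdorff d d').real A) * ((1 + ε) ^ d * (1 + ε) ^ d *
          (∫ x in A, W x ^ (1 + d / s) ∂(normHausdorff d d') + ε * (normHausdorff d d').real A) +
          ε * ((1 + ε) ^ d * (3 / 2) ^ (1 + d / s)))) ≤
      (1 - ε) ^ (-s) * ((normHausdorff d d').real A ^ (s / d) * (ℓ + ε)) + ε := by
  set h := normHausdorff d d'
  set H := h.real A with hH
  have hfin : h A ≠ ∞ := (normHausdorff_lt_top hA).ne
  have hcpt := isCompact_of_isRectifiableManifold hA
  have hne : A.Nonempty := by
    rw [nonempty_iff_ne_empty]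
    rintro rfl
    simp [hH] at hA0
  have hd0 : (0 : ℝ) < d := by exact_mod_cast hd
  have hs0 : 0 < s := hd0.trans hs
  have hp : 0 < s / d := div_pos hs0 hd0
  have hq : 0 ≤ 1 + d / s := by positivity
  have hWq : Continuous fun x => W x ^ (1 + d / s) := hW.rpow_const fun x => Or.inr hq
  obtain ⟨r₁, hr₁, hWr₁⟩ := exists_pos_forall_dist_le_abs_sub_le hcpt hW hε
  obtain ⟨r₂, hr₂, hWr₂⟩ := exists_pos_forall_dist_le_abs_sub_le hcpt hWq hε
  obtain ⟨δ, hδ, hmove⟩ := exists_move hd hs0 hA (M := ℓ + 1) (by linarith) hε hε1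
  obtain ⟨n, B, g, hB, hBA, hdisj, hBr, hg, hBδ⟩ :=
    exists_decomposition hA hne hε (lt_min hr₁ hr₂) hδ
  have hε'pos : 0 < ε / (n + 1) := by positivity
  obtain ⟨b, hb⟩ := ha.exists_weighted_le_energy ha0 hd hs0 hε.le hB hdisj hg hε'pos n
  have hx : ∀ i, ∃ x ∈ A, ∀ y ∈ B i, dist x y ≤ min r₁ r₂ := by
    intro i
    rcases (B i).eq_empty_or_nonempty with hi | ⟨x, hx⟩
    · exact ⟨hne.some, hne.some_mem, fun y hy => by simp [hi] at hy⟩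
    · exact ⟨x, hBA i hx, fun y hy => hBr i x hx y hy⟩
  choose z hzA hz using hx
  have hU : (⋃ i ∈ Finset.range n, B i) ⊆ A := iUnion₂_subset fun i _ => hBA i
  have hUcl : IsClosed (⋃ i ∈ Finset.range n, B i) :=
    ((Finset.range n).isCompact_biUnion fun i _ => hB i).isClosed
  have hNtop : Tendsto (fun N : ℕ => (N : ℝ) ^ (1 + s / d)) atTop atTop :=
    (tendsto_rpow_atTop (by positivity)).comp tendsto_natCast_atTop_atTop
  have hb0 : Tendsto (fun N : ℕ => H ^ (s / d) * b / (N : ℝ) ^ (1 + s / d)) atTop (𝓝 0) :=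
    hNtop.const_div_atTop _
  have hsum : ∑ i ∈ Finset.range n, (volume.real (g i '' B i) + ε / (n + 1)) * (1 + ε) ^ d *
      W (z i) ^ (1 + d / s) ≤ (1 + ε) ^ d * (1 + ε) ^ d * (∫ x in A, W x ^ (1 + d / s) ∂h + ε * H) +
          ε * ((1 + ε) ^ d * (3 / 2) ^ (1 + d / s)) := by
    have h1 := sum_measureReal_mul_le_setIntegral hcpt hfin hWq
      (fun x => Real.rpow_nonneg (hW1 x) _) hB hBA hdisj n hε.le
      (w := fun i => W (z i) ^ (1 + d / s)) (fun i x hx => by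
        have := (abs_le.1 (hWr₂ _ (hzA i) x (hBA i hx) ((hz i x hx).trans (min_le_right _ _)))).2
        linarith)
    have h2 : ∀ i ∈ Finset.range n, (volume.real (g i '' B i) + ε / (n + 1)) * (1 + ε) ^ d *
        W (z i) ^ (1 + d / s) ≤ (1 + ε) ^ d * (1 + ε) ^ d * (h.real (B i) * W (z i) ^ (1 + d / s)) +
          ε / (n + 1) * ((1 + ε) ^ d * (3 / 2) ^ (1 + d / s)) := by
      intro i _
      have h3 := volume_real_image_le (measure_ne_top_of_subset (hBA i) hfin) (c := 1 + ε)
        (by positivity) (fun x hx y hy => (hg i x hx y hy).2)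
      have h4 : W (z i) ^ (1 + d / s) ≤ (3 / 2) ^ (1 + d / s) :=
        Real.rpow_le_rpow (hW1 _) (hW2 _) hq
      have h5 : 0 ≤ W (z i) ^ (1 + d / s) := Real.rpow_nonneg (hW1 _) _
      calc _ = (1 + ε) ^ d * volume.real (g i '' B i) * W (z i) ^ (1 + d / s) +
            ε / (n + 1) * ((1 + ε) ^ d * W (z i) ^ (1 + d / s)) := by ring
        _ ≤ (1 + ε) ^ d * ((1 + ε) ^ d * h.real (B i)) * W (z i) ^ (1 + d / s) +
            ε / (n + 1) * ((1 + ε) ^ d * (3 / 2) ^ (1 + d / s)) := by gcongr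
        _ = _ := by ring
    refine (Finset.sum_le_sum h2).trans ?_
    rw [Finset.sum_add_distrib, ← Finset.mul_sum, Finset.sum_const, Finset.card_range,
      nsmul_eq_mul, ← mul_assoc (n : ℝ)]
    have h6 : (n : ℝ) * (ε / (n + 1)) ≤ ε := by
      rw [mul_div_assoc', div_le_iff₀ (by positivity)]
      linarith
    gcongr
  filter_upwards [hmove _ hUcl hBδ.le (min r₁ r₂) (lt_min hr₁ hr₂), eventually_ge_atTop 1,
    hE.eventually (ge_mem_nhds (show ℓ < ℓ + 1 by linarith)),
    hE.eventually (ge_mem_nhds (show ℓ < ℓ + ε by linarith)), hb0.eventually (ge_mem_nhds hε)]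
    with N hN hN1 hE1 hEε hbN
  have hN0 : (0 : ℝ) < N := by exact_mod_cast hN1
  have hNpos : 0 < (N : ℝ) ^ (1 + s / d) := by positivity
  rw [div_le_iff₀ hNpos] at hE1
  obtain ⟨ω₁, hω₁, hω₁card, π, hπ, hπd⟩ := hN (ω N) (hsub N) (hcard N) hE1
  have hπinj : Set.InjOn π ω₁ := by
    intro x hx y hy hxy
    have h1 := hπd x hx y hy
    rw [hxy, dist_self] at h1
    exact dist_le_zero.1 (nonpos_of_mul_nonpos_right h1 (by linarith))
  have hΩ : ↑(ω₁.image π) ⊆ ⋃ i ∈ Finset.range n, B i := by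
    intro y hy
    obtain ⟨x, hx, rfl⟩ := Finset.mem_image.1 hy
    exact (hπ x hx).1
  have hen : energy s (ω₁.image π) id ≤ (1 - ε) ^ (-s) * energy s (ω N) id := by
    rw [energy_image hπinj]
    refine (energy_le_of_dist_le hs0.le (c := 1 - ε) (x := id) (by linarith)
      (fun _ _ _ _ h => h) fun x hx y hy _ => hπd x hx y hy).trans ?_
    have : 0 ≤ (1 - ε) ^ (-s) := Real.rpow_nonneg (by linarith) _
    gcongr
    exact energy_mono hω₁ id
  have hW3 : ∑ x ∈ ω N, W x - 4 * ε * N ≤ ∑ i ∈ Finset.range n,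
      W (z i) * (((ω₁.image π).filter fun x => x ∈ B i).card : ℝ) := by
    have h1 := weighted_sum_sub_le hW2 hε.le hω₁ (hsub N) (by rwa [hcard N])
      (fun x hx => ⟨hU (hπ x hx).1, (hπ x hx).2.trans (min_le_left _ _)⟩) hWr₁
    rw [hcard N, ← Finset.sum_image (f := fun x => W x - ε) hπinj] at h1
    refine h1.trans (sum_sub_le_sum_card hdisj hΩ fun i x hx => ?_)
    have := (abs_le.1 (hWr₁ _ (hzA i) x (hBA i hx) ((hz i x hx).trans (min_le_left _ _)))).1
    linarith
  have hfinal := hb (ω₁.image π) (N / H) (fun i => W (z i)) (by positivity) (fun i => hW1 _)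
  set R := (1 + ε) ^ d * (1 + ε) ^ d * (∫ x in A, W x ^ (1 + d / s) ∂h + ε * H) +
          ε * ((1 + ε) ^ d * (3 / 2) ^ (1 + d / s))
  have hfac : 0 < H ^ (s / d) / (N : ℝ) ^ (1 + s / d) := by positivity
  have h1 : a * ((N / H) ^ (s / d) * ((1 + s / d) * (∑ x ∈ ω N, W x - 4 * ε * N) -
      s / d * (N / H) * R)) ≤ (1 - ε) ^ (-s) * energy s (ω N) id + b := by
    refine le_trans ?_ (hfinal.trans (add_le_add_left hen b))
    gcongr
  have h2 := mul_le_mul_of_nonneg_left h1 hfac.le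
  have h3 : H ^ (s / d) / (N : ℝ) ^ (1 + s / d) * (a * ((N / H) ^ (s / d) * ((1 + s / d) *
      (∑ x ∈ ω N, W x - 4 * ε * N) - s / d * (N / H) * R))) =
      a * ((1 + s / d) * ((1 / (N : ℝ)) * ∑ x ∈ ω N, W x - 4 * ε) - s / d * (1 / H) * R) := by
    rw [Real.rpow_add hN0, Real.rpow_one, Real.div_rpow hN0.le hA0.le]
    field_simp
  rw [h3] at h2
  refine h2.trans ?_
  have h4 : 0 ≤ (1 - ε) ^ (-s) * H ^ (s / d) :=
    mul_nonneg (Real.rpow_nonneg (by linarith) _) (by positivity)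
  calc _ = (1 - ε) ^ (-s) * H ^ (s / d) * (energy s (ω N) id / (N : ℝ) ^ (1 + s / d)) +
        H ^ (s / d) * b / (N : ℝ) ^ (1 + s / d) := by ring
    _ ≤ (1 - ε) ^ (-s) * H ^ (s / d) * (ℓ + ε) + ε := by gcongr
    _ = _ := by ring

/-- A weighted lower bound for the limiting energy: it couples the means of `W` along the
configurations and the mean of a power of `W` with respect to Hausdorff measure. -/
theorem eventually_weighted_mean_le (hd : 1 ≤ d) (hs : (d : ℝ) < s)
    {A : Set (EuclideanSpace ℝ (Fin d'))} (hA : IsRectifiableManifold d d' A)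
    (hA0 : 0 < (normHausdorff d d').real A) {a : ℝ} (ha : IsLowerConst d s a) (ha0 : 0 ≤ a)
    {ω : ℕ → Finset (EuclideanSpace ℝ (Fin d'))} (hsub : ∀ N, ↑(ω N) ⊆ A)
    (hcard : ∀ N, (ω N).card = N) {ℓ : ℝ} (hℓ : 0 ≤ ℓ)
    (hE : Tendsto (fun N : ℕ => energy s (ω N) id / (N : ℝ) ^ (1 + s / d)) atTop (𝓝 ℓ))
    {W : EuclideanSpace ℝ (Fin d') → ℝ} (hW : Continuous W) (hW1 : ∀ x, 0 ≤ W x)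
    (hW2 : ∀ x, W x ≤ 3 / 2) {τ : ℝ} (hτ : 0 < τ) :
    ∀ᶠ N : ℕ in atTop,
      a * ((1 + s / d) * ((1 / (N : ℝ)) * ∑ x ∈ ω N, W x) - s / d *
        ((∫ x in A, W x ^ (1 + d / s) ∂(normHausdorff d d')) / (normHausdorff d d').real A)) ≤
      ℓ * (normHausdorff d d').real A ^ (s / d) + τ := by
  set H := (normHausdorff d d').real A with hH
  set I := ∫ x in A, W x ^ (1 + d / s) ∂(normHausdorff d d')
  have hcont : ContinuousAt (fun ε : ℝ => (1 - ε) ^ (-s) * (H ^ (s / d) * (ℓ + ε)) + ε +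
      a * ((1 + s / d) * (4 * ε) + s / d * (1 / H) * ((1 + ε) ^ d * (1 + ε) ^ d * (I + ε * H) +
        ε * ((1 + ε) ^ d * (3 / 2) ^ (1 + d / s))))) 0 := by
    refine ContinuousAt.add (ContinuousAt.add (ContinuousAt.mul
      (ContinuousAt.rpow_const (by fun_prop) (Or.inl (by simp))) ?_) ?_) ?_ <;> fun_prop
  have hlim := hcont.tendsto.mono_left (nhdsWithin_le_nhds (s := Ioi 0))
  have hlt : ∀ᶠ ε : ℝ in 𝓝[>] 0, (1 - ε) ^ (-s) * (H ^ (s / d) * (ℓ + ε)) + ε +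
      a * ((1 + s / d) * (4 * ε) + s / d * (1 / H) * ((1 + ε) ^ d * (1 + ε) ^ d * (I + ε * H) +
        ε * ((1 + ε) ^ d * (3 / 2) ^ (1 + d / s)))) < ℓ * H ^ (s / d) + a * (s / d * (I / H)) + τ :=
    hlim.eventually (gt_mem_nhds (by
      simp only [sub_zero, Real.one_rpow, add_zero, mul_zero, one_pow, zero_mul, mul_one, one_mul,
        zero_add]
      have : s / d * (1 / H) * I = s / d * (I / H) := by ring
      rw [this]
      linarith))
  have hpos : ∀ᶠ ε : ℝ in 𝓝[>] 0, 0 < ε := self_mem_nhdsWithin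
  have hone : ∀ᶠ ε : ℝ in 𝓝[>] 0, ε < 1 := (gt_mem_nhds one_pos).filter_mono nhdsWithin_le_nhds
  obtain ⟨ε, h1, h2, h3⟩ := (hlt.and (hpos.and hone)).exists
  filter_upwards [eventually_weighted_mean_sub_le hd hs hA hA0 ha ha0 hsub hcard hℓ hE hW hW1 hW2
    h2 h3] with N hN
  rw [mul_sub] at hN ⊢
  linarith

end WeightedMean

section Equidistribution

variable {d d' : ℕ} {s : ℝ}

theorem exists_one_add_rpow_le (q : ℝ) {κ : ℝ} (hκ : 0 < κ) :
    ∃ r > 0, ∀ x : ℝ, |x| ≤ r → (1 + x) ^ q ≤ 1 + q * x + κ * |x| := by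
  have h1 := (Real.hasDerivAt_rpow_const (x := 1) (p := q) (Or.inl one_ne_zero)).isLittleO
  rw [Asymptotics.isLittleO_iff] at h1
  obtain ⟨r, hr, h⟩ := Metric.eventually_nhds_iff.1 (h1 hκ)
  refine ⟨r / 2, by positivity, fun x hx => ?_⟩
  have h2 := h (y := 1 + x) (by rw [Real.dist_eq, add_sub_cancel_left]; linarith)
  simp only [Real.one_rpow, mul_one, add_sub_cancel_left, smul_eq_mul, Real.norm_eq_abs] at h2
  linarith [(abs_le.1 h2).2]

theorem eventually_mean_sub_le_of_minimizing (hd : 1 ≤ d) (hs : (d : ℝ) < s)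
    {A : Set (EuclideanSpace ℝ (Fin d'))} (hA : IsRectifiableManifold d d' A)
    (hA0 : 0 < (normHausdorff d d').real A)
    {ω : ℕ → Finset (EuclideanSpace ℝ (Fin d'))} (hsub : ∀ N, ↑(ω N) ⊆ A)
    (hcard : ∀ N, (ω N).card = N) {ℓ : ℝ} (hℓ0 : 0 ≤ ℓ)
    (hE : Tendsto (fun N : ℕ => energy s (ω N) id / (N : ℝ) ^ (1 + s / d)) atTop (𝓝 ℓ))
    (hℓ : ∀ ε > 0, ∃ N₀ : ℕ, ∀ ω : Finset (EuclideanSpace ℝ (Fin d')), ↑ω ⊆ A → N₀ ≤ ω.card →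
      (ℓ - ε) * (ω.card : ℝ) ^ (1 + s / d) ≤ energy s ω id)
    {W : EuclideanSpace ℝ (Fin d') → ℝ} (hW : Continuous W) (hW1 : ∀ x, 0 ≤ W x)
    (hW2 : ∀ x, W x ≤ 3 / 2) {τ : ℝ} (hτ : 0 < τ) :
    ∀ᶠ N : ℕ in atTop, (1 + s / d) * ((1 / (N : ℝ)) * ∑ x ∈ ω N, W x) - s / d *
        ((∫ x in A, W x ^ (1 + d / s) ∂(normHausdorff d d')) / (normHausdorff d d').real A) ≤
      1 + τ := by
  set H := (normHausdorff d d').real A with hH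
  have hc0 : 0 < ℓ * H ^ (s / d) := by
    obtain ⟨a, ha0, ha⟩ := exists_isLowerConst_pos hd (d.cast_nonneg.trans hs.le)
    by_contra! hle
    have h1 := eventually_weighted_mean_le hd hs hA hA0 ha ha0.le hsub hcard hℓ0 hE
      (W := fun _ => 1) continuous_const (fun _ => zero_le_one) (fun _ => by norm_num)
      (half_pos ha0)
    obtain ⟨N, hN, hN1⟩ := (h1.and (eventually_ge_atTop 1)).exists
    have hN0 : (N : ℝ) ≠ 0 := by positivity
    simp only [Real.one_rpow, Finset.sum_const, hcard N, nsmul_eq_mul, mul_one, one_div,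
      inv_mul_cancel₀ hN0, setIntegral_const, smul_eq_mul, ← hH, div_self hA0.ne'] at hN
    linarith
  set a := ℓ * H ^ (s / d) / (1 + τ / 2) with ha
  have ha0 : 0 < a := by positivity
  have hmul : a * (1 + τ / 2) = ℓ * H ^ (s / d) := div_mul_cancel₀ _ (by positivity)
  have haτ : 0 < a * τ := mul_pos ha0 hτ
  have hlow : IsLowerConst d s a := by
    by_contra hcon
    have := mul_real_rpow_le_of_not_isLowerConst hd hs hA hA0 hℓ0 hℓ ha0.le hcon
    rw [← hH] at this
    linarith
  filter_upwards [eventually_weighted_mean_le hd hs hA hA0 hlow ha0.le hsub hcard hℓ0 hE hW hW1 hW2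
    (half_pos haτ)] with N hN
  rw [← hH] at hN
  refine le_of_mul_le_mul_left (hN.trans (le_of_eq ?_)) ha0
  rw [← hmul]
  ring

theorem eventually_mean_le_of_minimizing (hd : 1 ≤ d) (hs : (d : ℝ) < s)
    {A : Set (EuclideanSpace ℝ (Fin d'))} (hA : IsRectifiableManifold d d' A)
    (hA0 : 0 < (normHausdorff d d').real A)
    {ω : ℕ → Finset (EuclideanSpace ℝ (Fin d'))} (hsub : ∀ N, ↑(ω N) ⊆ A)
    (hcard : ∀ N, (ω N).card = N) {ℓ : ℝ} (hℓ0 : 0 ≤ ℓ)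
    (hE : Tendsto (fun N : ℕ => energy s (ω N) id / (N : ℝ) ^ (1 + s / d)) atTop (𝓝 ℓ))
    (hℓ : ∀ ε > 0, ∃ N₀ : ℕ, ∀ ω : Finset (EuclideanSpace ℝ (Fin d')), ↑ω ⊆ A → N₀ ≤ ω.card →
      (ℓ - ε) * (ω.card : ℝ) ^ (1 + s / d) ≤ energy s ω id)
    {f : EuclideanSpace ℝ (Fin d') → ℝ} (hf : Continuous f) {M : ℝ} (hM : 0 < M)
    (hfM : ∀ x, |f x| ≤ M) {τ : ℝ} (hτ : 0 < τ) :
    ∀ᶠ N : ℕ in atTop, (1 / (N : ℝ)) * ∑ x ∈ ω N, f x ≤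
      (∫ x in A, f x ∂(normHausdorff d d')) / (normHausdorff d d').real A + τ := by
  set h := normHausdorff d d'
  set H := h.real A with hH
  have hfin : h A ≠ ∞ := (normHausdorff_lt_top hA).ne
  have hAm := (isCompact_of_isRectifiableManifold hA).measurableSet
  have hd0 : (0 : ℝ) < d := by exact_mod_cast hd
  have hs0 : 0 < s := hd0.trans hs
  set p := s / d with hp
  have hp0 : 0 < p := div_pos hs0 hd0
  set q := 1 + d / s with hq
  have hpq : p * q = 1 + p := by
    rw [hp, hq]
    field_simp
    ring
  obtain ⟨r, hr, hrq⟩ := exists_one_add_rpow_le q (show 0 < τ / (2 * M) by positivity)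
  set η := min r (1 / 2) / M with hη
  have hη0 : 0 < η := div_pos (lt_min hr (by norm_num)) hM
  have hηM : η * M = min r (1 / 2) := div_mul_cancel₀ _ hM.ne'
  have hηf : ∀ x, |η * f x| ≤ η * M := fun x => by
    rw [abs_mul, abs_of_pos hη0]
    exact mul_le_mul_of_nonneg_left (hfM x) hη0.le
  have hηf2 : ∀ x, |η * f x| ≤ 1 / 2 := fun x => (hηf x).trans (hηM ▸ min_le_right _ _)
  have hbdd : ∀ {g : EuclideanSpace ℝ (Fin d') → ℝ} (C : ℝ), Continuous g → (∀ x, |g x| ≤ C) →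
      IntegrableOn g A h := fun C hg hC =>
    Measure.integrableOn_of_bounded hfin hg.aestronglyMeasurable (Eventually.of_forall hC)
  have hfInt : IntegrableOn f A h := hbdd M hf hfM
  have hWcont : Continuous fun x => 1 + η * f x := by fun_prop
  have hq0 : 0 ≤ q := by positivity
  have hWInt : IntegrableOn (fun x => (1 + η * f x) ^ q) A h := by
    refine hbdd (2 ^ q) (hWcont.rpow_const fun x => Or.inr hq0) fun x => ?_
    have h1 := abs_le.1 (hηf2 x)
    rw [abs_of_nonneg (Real.rpow_nonneg (by linarith) _)]
    exact Real.rpow_le_rpow (by linarith) (by linarith) hq0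
  have hInt : ∫ x in A, (1 + η * f x) ^ q ∂h ≤ H + q * η * ∫ x in A, f x ∂h + η * τ / 2 * H := by
    have hconst : IntegrableOn (fun _ => 1 + η * τ / 2) A h := integrableOn_const hfin
    have hInt' : IntegrableOn (fun x => (1 + η * τ / 2) + q * η * f x) A h :=
      hconst.add (hfInt.const_mul _)
    refine (setIntegral_mono_on hWInt hInt' hAm fun x _ => ?_).trans (le_of_eq ?_)
    · have h1 := hrq (η * f x) ((hηf x).trans (hηM ▸ min_le_left _ _))
      have h2 := mul_le_mul_of_nonneg_left (hηf x) (show 0 ≤ τ / (2 * M) by positivity)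
      have h3 : τ / (2 * M) * (η * M) = η * τ / 2 := by field_simp
      linarith
    · rw [integral_add hconst (hfInt.const_mul _), setIntegral_const,
        integral_const_mul, smul_eq_mul]
      ring
  filter_upwards [eventually_ge_atTop 1, eventually_mean_sub_le_of_minimizing hd hs hA hA0 hsub
    hcard hℓ0 hE hℓ hWcont (fun x => by linarith [(abs_le.1 (hηf2 x)).1])
    (fun x => by linarith [(abs_le.1 (hηf2 x)).2])
    (show 0 < (1 + p / 2) * η * τ by positivity)] with N hN1 hN
  have hN0 : (N : ℝ) ≠ 0 := by positivity
  have hmean : (1 / (N : ℝ)) * ∑ x ∈ ω N, (1 + η * f x) =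
      1 + η * ((1 / (N : ℝ)) * ∑ x ∈ ω N, f x) := by
    rw [Finset.sum_add_distrib, ← Finset.mul_sum, Finset.sum_const, hcard N, nsmul_eq_mul]
    field_simp
  rw [← hH, ← hp, ← hq, hmean] at hN
  have h4 : p * ((∫ x in A, (1 + η * f x) ^ q ∂h) / H) ≤
      p + (1 + p) * η * ((∫ x in A, f x ∂h) / H) + p * η * τ / 2 := by
    rw [← hpq]
    refine (mul_le_mul_of_nonneg_left (div_le_div_of_nonneg_right hInt hA0.le) hp0.le).trans
      (le_of_eq ?_)
    field_simp
  refine le_of_mul_le_mul_left ?_ (show 0 < (1 + p) * η by positivity)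
  linarith

theorem tendsto_energy_div {X : Type*} [MetricSpace X] {ω : ℕ → Finset X} {L : ℝ≥0∞}
    (hL : L ≠ ⊤) {q : ℝ}
    (h : Tendsto (fun N : ℕ => rieszEnergy s (ω N) / ENNReal.ofReal ((N : ℝ) ^ q)) atTop (𝓝 L)) :
    Tendsto (fun N : ℕ => energy s (ω N) id / (N : ℝ) ^ q) atTop (𝓝 L.toReal) := by
  refine ((ENNReal.tendsto_toReal hL).comp h).congr fun N => ?_
  rw [Function.comp_apply, ENNReal.toReal_div, rieszEnergy_eq_ofReal,
    ENNReal.toReal_ofReal (energy_nonneg _ _), ENNReal.toReal_ofReal (by positivity)]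

theorem exists_le_energy_of_tendsto_minRieszEnergy {X : Type*} [MetricSpace X] {A : Set X}
    {L : ℝ≥0∞} (hL : L ≠ ⊤) {q : ℝ}
    (h : Tendsto (fun N : ℕ => minRieszEnergy s A N / ENNReal.ofReal ((N : ℝ) ^ q)) atTop (𝓝 L))
    {ε : ℝ} (hε : 0 < ε) :
    ∃ N₀ : ℕ, ∀ ω : Finset X, ↑ω ⊆ A → N₀ ≤ ω.card →
      (L.toReal - ε) * (ω.card : ℝ) ^ q ≤ energy s ω id := by
  have h1 := ((ENNReal.tendsto_toReal hL).comp h).eventually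
    (le_mem_nhds (show L.toReal - ε < L.toReal by linarith))
  obtain ⟨N₀, hN₀⟩ := eventually_atTop.1 (h1.and (eventually_ge_atTop 1))
  refine ⟨N₀, fun ω hω hcard => ?_⟩
  obtain ⟨h2, h3⟩ := hN₀ _ hcard
  have h4 : minRieszEnergy s A ω.card ≤ ENNReal.ofReal (energy s ω id) := by
    rw [← rieszEnergy_eq_ofReal]
    exact iInf_le_of_le ω (iInf_le_of_le hω (iInf_le_of_le rfl le_rfl))
  have h5 := ENNReal.toReal_mono ENNReal.ofReal_ne_top h4
  rw [ENNReal.toReal_ofReal (energy_nonneg _ _)] at h5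
  have h6 : (0 : ℝ) < ω.card := by exact_mod_cast h3
  rw [Function.comp_apply, ENNReal.toReal_div, ENNReal.toReal_ofReal (by positivity),
    le_div_iff₀ (by positivity)] at h2
  exact h2.trans h5

end Equidistribution

end RieszEnergy

/-- asymptotically `s`-energy minimizing configurations (for `s > d`) on a
`d`-rectifiable manifold `A ⊆ ℝ^{d'}` with `H_d(A) > 0` are asymptotically uniformly
distributed with respect to `H_d` on `A`. -/
theorem asympt_minimizing_equidistributed_of_rectifiableManifold (d d' : ℕ) (hd : 1 ≤ d)
    (hdd : d ≤ d') (s : ℝ) (hs : (d : ℝ) < s)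
    (A : Set (EuclideanSpace ℝ (Fin d'))) (hA : IsRectifiableManifold d d' A)
    (hA0 : 0 < normHausdorff d d' A)
    (ω : ℕ → Finset (EuclideanSpace ℝ (Fin d')))
    (hsub : ∀ N, ↑(ω N) ⊆ A) (hcard : ∀ N, (ω N).card = N)
    (L : ℝ≥0∞) (hLfin : L ≠ ⊤)
    (hmin : Tendsto
      (fun N : ℕ => minRieszEnergy s A N / ENNReal.ofReal ((N : ℝ) ^ (1 + s / (d : ℝ))))
      atTop (𝓝 L))
    (hω : Tendsto
      (fun N : ℕ => rieszEnergy s (ω N) / ENNReal.ofReal ((N : ℝ) ^ (1 + s / (d : ℝ))))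
      atTop (𝓝 L)) :
    ∀ f : EuclideanSpace ℝ (Fin d') → ℝ, Continuous f → (∃ M : ℝ, ∀ x, |f x| ≤ M) →
      Tendsto (fun N : ℕ => (1 / (N : ℝ)) * ∑ x ∈ ω N, f x) atTop
        (𝓝 ((∫ x in A, f x ∂(normHausdorff d d')) / ((normHausdorff d d') A).toReal)) := by
  intro f hf ⟨M, hfM⟩
  have hApos : 0 < (normHausdorff d d').real A :=
    ENNReal.toReal_pos hA0.ne' (RieszEnergy.normHausdorff_lt_top hA).ne
  have hM : 0 < M + 1 := by linarith [(abs_nonneg (f 0)).trans (hfM 0)]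
  have key : ∀ {g : EuclideanSpace ℝ (Fin d') → ℝ}, Continuous g → (∀ x, |g x| ≤ M) →
      ∀ {τ : ℝ}, 0 < τ → ∀ᶠ N : ℕ in atTop, (1 / (N : ℝ)) * ∑ x ∈ ω N, g x ≤
        (∫ x in A, g x ∂(normHausdorff d d')) / (normHausdorff d d').real A + τ :=
    fun hg hgM _ hτ => RieszEnergy.eventually_mean_le_of_minimizing hd hs hA hApos hsub hcard
      ENNReal.toReal_nonneg (RieszEnergy.tendsto_energy_div hLfin hω)
      (fun _ hε => RieszEnergy.exists_le_energy_of_tendsto_minRieszEnergy hLfin hmin hε) hg hM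
      (fun x => (hgM x).trans (by linarith)) hτ
  refine Metric.tendsto_nhds.2 fun τ hτ => ?_
  filter_upwards [key hf hfM (half_pos hτ),
    key hf.neg (fun x => (abs_neg (f x)).trans_le (hfM x)) (half_pos hτ)] with N h1 h2
  simp only [Pi.neg_apply, Finset.sum_neg_distrib, integral_neg, mul_neg, neg_div] at h2
  rw [Real.dist_eq, abs_lt]
  rw [Measure.real] at h1 h2
  constructor <;> linarith
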